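/- Fix 1 ≤ l ≤ r and set 𝔥 = so(k_1)⊕⋯⊕so(k_l) and 𝔨 = so(k_{l+1})⊕⋯⊕so(k_r) (block-diagonally embedded in so(n), so that so(n)_A = 𝔥 ⊕ 𝔨), and let p = 𝔨 ⊕ v. For M ∈ p let j_M = {η ∈ p : tr([M, η]·X) = 0 for all X ∈ 𝔥}, and let F_M ⊆ p be the real linear span of the orthogonal projections onto p of the matrices π((M + λA)^j), λ ∈ ℝ, j ∈ ℕ. Then there is an open dense subset U ⊆ p such that for every M ∈ U the subspace F_M + 𝔨 is coisotropic inside j_M: every η ∈ j_M satisfying tr(M·[ξ, η]) = 0 for all ξ ∈ F_M + 𝔨 belongs to F_M + 𝔨. (This expresses that the restricted Manakov integrals L_p together with the linear functions on 𝔨 form a complete subset of the Ad_H-invariant polynomials on p, H = SO(k_1)×⋯×SO(k_l); Theorem 4(i) of the paper, used to prove integrability of the Einstein metrics on Stiefel manifolds V(n,k) = SO(n)/SO(k).) -/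

import Mathlib

open Matrix

/-- The skew-symmetric part `π(P) = (P − Pᵀ)/2` of a matrix. -/
noncomputable def skewPart {n : ℕ} (P : Matrix (Fin n) (Fin n) ℝ) :
    Matrix (Fin n) (Fin n) ℝ :=
  (1 / 2 : ℝ) • (P - Pᵀ)

/-- The subalgebra `𝔥 = so(k 1) ⊕ ⋯ ⊕ so(k l)`: skew matrices supported on the
diagonal blocks with block index `< l`. -/
def hSet {n r : ℕ} (blk : Fin n → Fin r) (l : ℕ) : Set (Matrix (Fin n) (Fin n) ℝ) :=
  {X | Xᵀ = -X ∧ ∀ i j, ¬(blk i = blk j ∧ (blk i : ℕ) < l) → X i j = 0}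

/-- The subalgebra `𝔨 = so(k (l+1)) ⊕ ⋯ ⊕ so(k r)`: skew matrices supported on the
diagonal blocks with block index `≥ l`. -/
def kSet {n r : ℕ} (blk : Fin n → Fin r) (l : ℕ) : Set (Matrix (Fin n) (Fin n) ℝ) :=
  {X | Xᵀ = -X ∧ ∀ i j, ¬(blk i = blk j ∧ l ≤ (blk i : ℕ)) → X i j = 0}

/-- The subspace `p = 𝔨 ⊕ v`: skew matrices whose diagonal blocks with block index
`< l` vanish. -/
def pSet {n r : ℕ} (blk : Fin n → Fin r) (l : ℕ) : Set (Matrix (Fin n) (Fin n) ℝ) :=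
  {X | Xᵀ = -X ∧ ∀ i j, blk i = blk j → (blk i : ℕ) < l → X i j = 0}

/-- The orthogonal projection onto `p`: kill the diagonal blocks with block index `< l`. -/
def projP {n r : ℕ} (blk : Fin n → Fin r) (l : ℕ) (X : Matrix (Fin n) (Fin n) ℝ) :
    Matrix (Fin n) (Fin n) ℝ :=
  Matrix.of fun i j => if blk i = blk j ∧ (blk i : ℕ) < l then 0 else X i j

/-- The gradients on `p` of the restricted Manakov integrals `tr((M + λA)^k)`, `M ∈ p`:
the projections onto `p` of `π((M + λA)^j)`. -/
noncomputable def pManakovGradients {n r : ℕ} (blk : Fin n → Fin r) (l : ℕ)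
    (A M : Matrix (Fin n) (Fin n) ℝ) : Set (Matrix (Fin n) (Fin n) ℝ) :=
  {P | ∃ (lam : ℝ) (j : ℕ), P = projP blk l (skewPart ((M + lam • A) ^ j))}

/-- `j_M = {η ∈ p : tr([M, η]·X) = 0 for all X ∈ 𝔥}`. -/
def jSet {n r : ℕ} (blk : Fin n → Fin r) (l : ℕ) (M : Matrix (Fin n) (Fin n) ℝ) :
    Set (Matrix (Fin n) (Fin n) ℝ) :=
  {η | η ∈ pSet blk l ∧ ∀ X ∈ hSet blk l, ((M * η - η * M) * X).trace = 0}


section mkHelpers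
open Module


theorem mk_exists_det {E κ ι : Type*} [Fintype κ] [DecidableEq κ] [AddCommGroup E] [Module ℝ E]
    (bs : Basis κ ℝ E) (f : ι → E) (h : Submodule.span ℝ (Set.range f) = ⊤) :
    ∃ c : κ → ι, bs.det (fun a => f (c a)) ≠ 0 := by
  obtain ⟨κ', a, ha, hsp, hli⟩ := exists_linearIndependent' ℝ f
  have B := Basis.mk hli (by rw [hsp, h])
  let B := Basis.mk hli (by rw [hsp, h])
  let e := B.indexEquiv bs
  refine ⟨fun k => a (e.symm k), ?_⟩
  have := (B.reindex e)
  have h2 : (fun k => f (a (e.symm k))) = B.reindex e := by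
    funext k
    simp [B]
  rw [h2]
  exact (bs.isUnit_det _).ne_zero

theorem mk_span_of_det {E κ ι : Type*} [Fintype κ] [DecidableEq κ] [AddCommGroup E] [Module ℝ E]
    (bs : Basis κ ℝ E) (f : ι → E) (c : κ → ι) (h : bs.det (fun a => f (c a)) ≠ 0) :
    Submodule.span ℝ (Set.range fun a => f (c a)) = ⊤ :=
  (Basis.is_basis_iff_det bs).2 (isUnit_iff_ne_zero.2 h) |>.2

theorem mk_span_open {E κ ι P : Type*} [Fintype κ] [DecidableEq κ] [AddCommGroup E] [Module ℝ E]
    [TopologicalSpace P]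
    (bs : Basis κ ℝ E) (g : ι → P → E) (p0 : P)
    (hg : ∀ k i, Continuous fun p => bs.repr (g k p) i)
    (h : Submodule.span ℝ (Set.range fun k => g k p0) = ⊤) :
    ∃ c : κ → ι, ∀ᶠ p in nhds p0, Submodule.span ℝ (Set.range fun a => g (c a) p) = ⊤ := by
  obtain ⟨c, hc⟩ := mk_exists_det bs _ h
  refine ⟨c, ?_⟩
  have hcont : Continuous fun p => bs.det (fun a => g (c a) p) := by
    simp only [Basis.det_apply]
    apply Continuous.matrix_det
    refine continuous_matrix fun i j => ?_
    simpa [Basis.toMatrix_apply] using hg (c j) i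
  have := hcont.continuousAt.eventually_ne hc
  filter_upwards [this] with p hp
  exact mk_span_of_det bs (fun k => g k p) c hp

theorem mk_span_poly {E κ ι : Type*} [Fintype κ] [DecidableEq κ] [AddCommGroup E] [Module ℝ E]
    (bs : Basis κ ℝ E) (g : ι → ℝ → E) (s0 : ℝ)
    (hg : ∀ k i, ∃ P : Polynomial ℝ, ∀ s, bs.repr (g k s) i = P.eval s)
    (h : Submodule.span ℝ (Set.range fun k => g k s0) = ⊤) (s1 : ℝ) :
    ∀ᶠ s in nhdsWithin s1 {s1}ᶜ, Submodule.span ℝ (Set.range fun k => g k s) = ⊤ := by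
  obtain ⟨c, hc⟩ := mk_exists_det bs _ h
  choose P hP using hg
  let D : Polynomial ℝ := (Matrix.of fun i j => P (c j) i).det
  have hD : ∀ s, bs.det (fun a => g (c a) s) = D.eval s := by
    intro s
    rw [Basis.det_apply]
    change _ = Polynomial.evalRingHom s _
    rw [RingHom.map_det]
    congr 1
    ext i j
    simp [Basis.toMatrix_apply, hP]
  have hD0 : D ≠ 0 := by
    rintro h0
    rw [hD, h0] at hc
    simp at hc
  have hfin : (D.rootSet ℝ).Finite := Polynomial.rootSet_finite D ℝ
  have : ∀ᶠ s in nhdsWithin s1 {s1}ᶜ, s ∉ D.rootSet ℝ := by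
    have h1 : ∀ᶠ s in nhdsWithin s1 {s1}ᶜ, s ∉ (D.rootSet ℝ \ {s1}) := by
      apply Filter.Eventually.filter_mono nhdsWithin_le_nhds
      exact (hfin.subset Set.sdiff_subset).isClosed.isOpen_compl.mem_nhds (by simp)
    filter_upwards [h1, self_mem_nhdsWithin] with s hs hs1 hs2
    exact hs ⟨hs2, hs1⟩
  filter_upwards [this] with s hs
  have hne : D.eval s ≠ 0 := by
    intro h0
    exact hs (by rw [Polynomial.mem_rootSet]; exact ⟨hD0, by simpa using h0⟩)
  rw [← hD] at hne
  have := mk_span_of_det bs (fun k => g k s) c hne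
  rw [eq_top_iff, ← this]
  apply Submodule.span_mono
  rintro _ ⟨a, rfl⟩
  exact ⟨c a, rfl⟩

/-- polynomial curves of matrices -/
def MkPoly {n : ℕ} (f : ℝ → Matrix (Fin n) (Fin n) ℝ) : Prop :=
  ∃ F : Matrix (Fin n) (Fin n) (Polynomial ℝ), ∀ s, f s = F.map (Polynomial.eval s)

namespace MkPoly
variable {n : ℕ} {f g : ℝ → Matrix (Fin n) (Fin n) ℝ}

theorem const (X : Matrix (Fin n) (Fin n) ℝ) : MkPoly (fun _ => X) :=
  ⟨X.map Polynomial.C, fun s => by ext i j; simp⟩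

theorem add (hf : MkPoly f) (hg : MkPoly g) : MkPoly (fun s => f s + g s) := by
  obtain ⟨F, hF⟩ := hf
  obtain ⟨G, hG⟩ := hg
  exact ⟨F + G, fun s => by ext i j; simp [hF, hG]⟩

theorem sub (hf : MkPoly f) (hg : MkPoly g) : MkPoly (fun s => f s - g s) := by
  obtain ⟨F, hF⟩ := hf
  obtain ⟨G, hG⟩ := hg
  exact ⟨F - G, fun s => by ext i j; simp [hF, hG]⟩

theorem mul (hf : MkPoly f) (hg : MkPoly g) : MkPoly (fun s => f s * g s) := by
  obtain ⟨F, hF⟩ := hf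
  obtain ⟨G, hG⟩ := hg
  exact ⟨F * G, fun s => by
    ext i j; simp [hF, hG, Matrix.mul_apply, Polynomial.eval_finsetSum]⟩

theorem pow (hf : MkPoly f) (k : ℕ) : MkPoly (fun s => f s ^ k) := by
  induction k with
  | zero => simpa using const 1
  | succ k ih => simpa [pow_succ] using ih.mul hf

theorem line (X Y : Matrix (Fin n) (Fin n) ℝ) : MkPoly (fun s => X + s • Y) :=
  ⟨X.map Polynomial.C + (Polynomial.X : Polynomial ℝ) • Y.map Polynomial.C, fun s => by
    ext i j; simp; ring⟩

end MkPoly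


section mkOmega
variable {n r : ℕ} (blk : Fin n → Fin r) (l : ℕ) (A : Matrix (Fin n) (Fin n) ℝ)

/-- constant part: symmetric off the blocks, inside `S` -/
def mkC (S : Finset (Fin n)) : Submodule ℝ (Matrix (Fin n) (Fin n) ℝ) where
  carrier := {X | ∀ a ∈ S, ∀ b ∈ S, blk a ≠ blk b → X a b = X b a}
  add_mem' := by
    intro X Y hX hY a ha b hb hab
    simp [hX a ha b hb hab, hY a ha b hb hab]
  zero_mem' := by intro a _ b _ _; simp
  smul_mem' := by
    intro c X hX a ha b hb hab
    simp [hX a ha b hb hab]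

/-- block diagonal matrices supported on blocks with index `< l` -/
def mkH : Submodule ℝ (Matrix (Fin n) (Fin n) ℝ) where
  carrier := {X | ∀ a b, ¬(blk a = blk b ∧ (blk a : ℕ) < l) → X a b = 0}
  add_mem' := by
    intro X Y hX hY a b hab
    simp [hX a b hab, hY a b hab]
  zero_mem' := by intro a b _; simp
  smul_mem' := by
    intro c X hX a b hab
    simp [hX a b hab]

abbrev MkIdx (S : Finset (Fin n)) := mkC blk S ⊕ mkH blk l ⊕ (ℝ × ℕ) ⊕ (ℝ × ℕ)

/-- the generators -/
def mkGen (S : Finset (Fin n)) (k : MkIdx blk l S) (M : Matrix (Fin n) (Fin n) ℝ) :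
    Matrix (Fin n) (Fin n) ℝ :=
  match k with
  | .inl X => X.1
  | .inr (.inl X) => M * X.1 - X.1 * M
  | .inr (.inr (.inl p)) => (M + p.1 • A) ^ p.2
  | .inr (.inr (.inr p)) => M * (M + p.1 • A) ^ p.2 - (M + p.1 • A) ^ p.2 * M

def mkOm (S : Finset (Fin n)) (M : Matrix (Fin n) (Fin n) ℝ) :
    Submodule ℝ (Matrix (Fin n) (Fin n) ℝ) :=
  Submodule.span ℝ (Set.range fun k => mkGen blk l A S k M)

/-- admissible matrices supported on `S` -/
def mkAdm (S : Finset (Fin n)) : Submodule ℝ (Matrix (Fin n) (Fin n) ℝ) where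
  carrier := {M | Mᵀ = -M ∧ (∀ i j, blk i = blk j → (blk i : ℕ) < l → M i j = 0) ∧
    ∀ i j, i ∉ S → M i j = 0}
  add_mem' := by
    rintro X Y ⟨hX, hX2, hX3⟩ ⟨hY, hY2, hY3⟩
    refine ⟨by simp [hX, hY, add_comm], fun i j h h' => by simp [hX2 i j h h', hY2 i j h h'],
      fun i j h => by simp [hX3 i j h, hY3 i j h]⟩
  zero_mem' := by simp
  smul_mem' := by
    rintro c X ⟨hX, hX2, hX3⟩
    refine ⟨by simp [hX], fun i j h h' => by simp [hX2 i j h h'],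
      fun i j h => by simp [hX3 i j h]⟩

theorem mkGen_continuous (S : Finset (Fin n)) (k : MkIdx blk l S) :
    Continuous fun M => mkGen blk l A S k M := by
  rcases k with X | X | p | p <;> simp only [mkGen] <;> fun_prop

theorem mkGen_poly (S : Finset (Fin n)) (k : MkIdx blk l S) (X Y : Matrix (Fin n) (Fin n) ℝ) :
    MkPoly fun s => mkGen blk l A S k (X + s • Y) := by
  have hl := MkPoly.line X Y
  have hp : ∀ p : ℝ × ℕ, MkPoly fun s => ((X + s • Y) + p.1 • A) ^ p.2 :=
    fun p => (hl.add (MkPoly.const _)).pow _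
  rcases k with Z | Z | p | p <;> simp only [mkGen]
  · exact MkPoly.const _
  · exact (hl.mul (MkPoly.const _)).sub ((MkPoly.const _).mul hl)
  · exact hp p
  · exact (hl.mul (hp p)).sub ((hp p).mul hl)

theorem mkOm_open (S : Finset (Fin n)) (M : Matrix (Fin n) (Fin n) ℝ)
    (h : mkOm blk l A S M = ⊤) : ∀ᶠ M' in nhds M, mkOm blk l A S M' = ⊤ := by
  obtain ⟨c, hc⟩ := mk_span_open (Matrix.stdBasis ℝ (Fin n) (Fin n))
    (fun k M => mkGen blk l A S k M) M (by
      rintro k ⟨i, j⟩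
      have := mkGen_continuous blk l A S k
      have := this.matrix_elem i j
      simpa [Matrix.stdBasis] using this) h
  filter_upwards [hc] with M' hM'
  rw [eq_top_iff, ← hM']
  apply Submodule.span_mono
  rintro _ ⟨a, rfl⟩
  exact ⟨c a, rfl⟩

theorem mkOm_line (S : Finset (Fin n)) (X Y : Matrix (Fin n) (Fin n) ℝ)
    (h : mkOm blk l A S (X + Y) = ⊤) :
    ∀ᶠ s in nhdsWithin (0 : ℝ) {0}ᶜ, mkOm blk l A S (X + s • Y) = ⊤ := by
  refine mk_span_poly (Matrix.stdBasis ℝ (Fin n) (Fin n))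
    (fun k s => mkGen blk l A S k (X + s • Y)) 1 ?_ (by simpa [mkOm] using h) 0
  rintro k ⟨i, j⟩
  obtain ⟨F, hF⟩ := mkGen_poly blk l A S k X Y
  refine ⟨F i j, fun s => ?_⟩
  have := hF s
  simp only at this ⊢
  rw [this]
  simp [Matrix.stdBasis]

end mkOmega


section mkFinal
variable {n r : ℕ} {blk : Fin n → Fin r} {l : ℕ}

theorem mk_trace_zero {N y : Matrix (Fin n) (Fin n) ℝ} (h : ∀ a b, N a b = 0 ∨ y b a = 0) :
    (N * y).trace = 0 := by
  simp only [Matrix.trace, Matrix.diag, Matrix.mul_apply]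
  refine Finset.sum_eq_zero fun a _ => Finset.sum_eq_zero fun b _ => ?_
  rcases h a b with h | h <;> simp [h]

theorem mk_trace_comm (M X Y : Matrix (Fin n) (Fin n) ℝ) :
    ((M * X - X * M) * Y).trace = - (X * (M * Y - Y * M)).trace := by
  have h1 : (M * X * Y).trace = (X * Y * M).trace := by
    rw [Matrix.mul_assoc, Matrix.trace_mul_comm]
  simp only [Matrix.sub_mul, Matrix.mul_sub, Matrix.trace_sub, h1, ← Matrix.mul_assoc]
  ring

theorem mk_invol (A M : Matrix (Fin n) (Fin n) ℝ) (s t : ℝ) (j k : ℕ) :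
    ((M + s • A) ^ j * (M * (M + t • A) ^ k - (M + t • A) ^ k * M)).trace = 0 := by
  set P := (M + s • A) ^ j with hP
  set Q := (M + t • A) ^ k with hQ
  have cP : (M + s • A) * P = P * (M + s • A) := (Commute.self_pow _ _).eq
  have cQ : (M + t • A) * Q = Q * (M + t • A) := (Commute.self_pow _ _).eq
  by_cases hst : s = t
  · subst hst
    have hc : P * Q = Q * P := ((Commute.refl (M + s • A)).pow_pow j k).eq
    have h1 : (P * (M * Q)).trace = (P * (Q * M)).trace := by
      rw [← Matrix.mul_assoc, Matrix.trace_mul_comm, ← Matrix.mul_assoc, ← hc, Matrix.mul_assoc]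
    rw [Matrix.mul_sub, Matrix.trace_sub, h1, sub_self]
  · have h1 : (P * ((M + s • A) * Q - Q * (M + s • A))).trace = 0 := by
      have : (P * (Q * (M + s • A))).trace = (P * ((M + s • A) * Q)).trace := by
        rw [← Matrix.mul_assoc, Matrix.trace_mul_comm, ← Matrix.mul_assoc, cP, Matrix.mul_assoc]
      rw [Matrix.mul_sub, Matrix.trace_sub, this, sub_self]
    have h2 : (P * ((M + t • A) * Q - Q * (M + t • A))).trace = 0 := by
      rw [cQ, sub_self]; simp
    have h3 : (s - t) • (P * (M * Q - Q * M)) =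
        s • (P * ((M + t • A) * Q - Q * (M + t • A)))
        - t • (P * ((M + s • A) * Q - Q * (M + s • A))) := by
      simp only [Matrix.add_mul, Matrix.mul_add, Matrix.mul_sub, Matrix.smul_mul, Matrix.mul_smul,
        smul_add, smul_sub, sub_smul, smul_smul]
      rw [mul_comm s t]
      abel
    have h4 := congrArg Matrix.trace h3
    rw [Matrix.trace_sub, Matrix.trace_smul, Matrix.trace_smul, Matrix.trace_smul, h1, h2] at h4
    simpa [sub_eq_zero, hst] using h4

/-- span of powers of the pencil -/
def mkL (A M : Matrix (Fin n) (Fin n) ℝ) : Submodule ℝ (Matrix (Fin n) (Fin n) ℝ) :=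
  Submodule.span ℝ (Set.range fun p : ℝ × ℕ => (M + p.1 • A) ^ p.2)

theorem mkL_invol {A M P Q : Matrix (Fin n) (Fin n) ℝ} (hP : P ∈ mkL A M) (hQ : Q ∈ mkL A M) :
    (P * (M * Q - Q * M)).trace = 0 := by
  induction hP using Submodule.span_induction with
  | zero => simp
  | add x y _ _ hx hy => rw [Matrix.add_mul, Matrix.trace_add, hx, hy, add_zero]
  | smul c x _ hx => rw [Matrix.smul_mul, Matrix.trace_smul, hx, smul_zero]
  | mem x hx =>
    obtain ⟨⟨s, j⟩, rfl⟩ := hx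
    induction hQ using Submodule.span_induction with
    | zero => simp
    | add x y _ _ hx hy =>
      have : M * (x + y) - (x + y) * M = (M * x - x * M) + (M * y - y * M) := by
        simp only [Matrix.mul_add, Matrix.add_mul]; abel
      rw [this, Matrix.mul_add, Matrix.trace_add, hx, hy, add_zero]
    | smul c x _ hx =>
      have : M * (c • x) - (c • x) * M = c • (M * x - x * M) := by
        simp only [Matrix.mul_smul, Matrix.smul_mul, smul_sub]
      rw [this, Matrix.mul_smul, Matrix.trace_smul, hx, smul_zero]
    | mem x hx =>
      obtain ⟨⟨t, k⟩, rfl⟩ := hx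
      exact mk_invol A M s t j k

theorem mkL_transpose {A M P : Matrix (Fin n) (Fin n) ℝ} (hM : Mᵀ = -M) (hA : Aᵀ = A)
    (hP : P ∈ mkL A M) : Pᵀ ∈ mkL A M := by
  induction hP using Submodule.span_induction with
  | zero => simp
  | add x y _ _ hx hy => rw [Matrix.transpose_add]; exact add_mem hx hy
  | smul c x _ hx => rw [Matrix.transpose_smul]; exact Submodule.smul_mem _ _ hx
  | mem x hx =>
    obtain ⟨⟨s, j⟩, rfl⟩ := hx
    have : ((M + s • A) ^ j)ᵀ = ((-1 : ℝ) ^ j) • (M + (-s) • A) ^ j := by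
      rw [← smul_pow, Matrix.transpose_pow]
      congr 1
      rw [Matrix.transpose_add, Matrix.transpose_smul, hM, hA]
      simp
    simp only
    rw [this]
    exact Submodule.smul_mem _ _ (Submodule.subset_span ⟨(-s, j), rfl⟩)

theorem mkL_skew {A M P : Matrix (Fin n) (Fin n) ℝ} (hM : Mᵀ = -M) (hA : Aᵀ = A)
    (hP : P ∈ mkL A M) : skewPart P ∈ mkL A M :=
  Submodule.smul_mem _ _ (sub_mem hP (mkL_transpose hM hA hP))

theorem mkL_blk {α : Fin r → ℝ} {M P : Matrix (Fin n) (Fin n) ℝ}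
    (hP : P ∈ mkL (Matrix.diagonal fun i => α (blk i)) M) (a b : Fin n) (hab : blk a = blk b) :
    (M * P - P * M) a b = 0 := by
  set A := Matrix.diagonal fun i => α (blk i) with hA
  induction hP using Submodule.span_induction with
  | zero => simp
  | add x y _ _ hx hy =>
      have : M * (x + y) - (x + y) * M = (M * x - x * M) + (M * y - y * M) := by
        simp only [Matrix.mul_add, Matrix.add_mul]; abel
      rw [this, Matrix.add_apply, hx, hy, add_zero]
  | smul c x _ hx =>
      have : M * (c • x) - (c • x) * M = c • (M * x - x * M) := by
        simp only [Matrix.mul_smul, Matrix.smul_mul, smul_sub]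
      rw [this, Matrix.smul_apply, hx, smul_zero]
  | mem x hx =>
    obtain ⟨⟨s, j⟩, rfl⟩ := hx
    simp only
    have c : (M + s • A) * (M + s • A) ^ j = (M + s • A) ^ j * (M + s • A) :=
      (Commute.self_pow _ _).eq
    have : M * (M + s • A) ^ j - (M + s • A) ^ j * M =
      s • ((M + s • A) ^ j * A - A * (M + s • A) ^ j) := by
      rw [Matrix.add_mul, Matrix.mul_add] at c
      simp only [Matrix.smul_mul, Matrix.mul_smul] at c
      rw [smul_sub, sub_eq_sub_iff_add_eq_add, c]
      abel
    rw [this, hA]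
    simp [Matrix.mul_diagonal, Matrix.diagonal_mul, hab, mul_comm]

theorem mkL_grad {A M P : Matrix (Fin n) (Fin n) ℝ} (hP : P ∈ mkL A M) :
    projP blk l (skewPart P) ∈ Submodule.span ℝ (pManakovGradients blk l A M) := by
  induction hP using Submodule.span_induction with
  | zero =>
    have : projP blk l (skewPart (0 : Matrix (Fin n) (Fin n) ℝ)) = 0 := by
      ext i j; simp [projP, skewPart]
    rw [this]; exact zero_mem _
  | add x y _ _ hx hy =>
    have : projP blk l (skewPart (x + y)) = projP blk l (skewPart x) + projP blk l (skewPart y) := by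
      ext i j
      simp only [projP, skewPart, Matrix.of_apply, Matrix.add_apply]
      split_ifs
      · simp
      · simp; ring
    rw [this]; exact add_mem hx hy
  | smul c x _ hx =>
    have : projP blk l (skewPart (c • x)) = c • projP blk l (skewPart x) := by
      ext i j
      simp only [projP, skewPart, Matrix.of_apply, Matrix.smul_apply]
      split_ifs
      · simp
      · simp; ring
    rw [this]; exact Submodule.smul_mem _ _ hx
  | mem x hx =>
    obtain ⟨⟨s, j⟩, rfl⟩ := hx
    exact Submodule.subset_span ⟨s, j, rfl⟩

theorem mkOm_decomp {A M Z : Matrix (Fin n) (Fin n) ℝ} {S : Finset (Fin n)}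
    (hZ : Z ∈ mkOm blk l A S M) :
    ∃ c ∈ mkC blk S, ∃ P ∈ mkL A M, ∃ x ∈ mkH blk l, ∃ Q ∈ mkL A M,
      Z = c + P + (M * (x + Q) - (x + Q) * M) := by
  induction hZ using Submodule.span_induction with
  | zero => exact ⟨0, zero_mem _, 0, zero_mem _, 0, zero_mem _, 0, zero_mem _, by simp⟩
  | add y z _ _ hy hz =>
    obtain ⟨c, hc, P, hP, x, hx, Q, hQ, rfl⟩ := hy
    obtain ⟨c', hc', P', hP', x', hx', Q', hQ', rfl⟩ := hz
    refine ⟨c + c', add_mem hc hc', P + P', add_mem hP hP', x + x', add_mem hx hx', Q + Q',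
      add_mem hQ hQ', ?_⟩
    simp only [Matrix.mul_add, Matrix.add_mul]; abel
  | smul d y _ hy =>
    obtain ⟨c, hc, P, hP, x, hx, Q, hQ, rfl⟩ := hy
    refine ⟨d • c, Submodule.smul_mem _ _ hc, d • P, Submodule.smul_mem _ _ hP, d • x,
      Submodule.smul_mem _ _ hx, d • Q, Submodule.smul_mem _ _ hQ, ?_⟩
    simp only [Matrix.mul_add, Matrix.add_mul, Matrix.mul_smul, Matrix.smul_mul, smul_add, smul_sub]
  | mem y hy =>
    obtain ⟨k, rfl⟩ := hy
    rcases k with X | X | p | p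
    · exact ⟨X.1, X.2, 0, zero_mem _, 0, zero_mem _, 0, zero_mem _, by simp [mkGen]⟩
    · exact ⟨0, zero_mem _, 0, zero_mem _, X.1, X.2, 0, zero_mem _, by simp [mkGen]⟩
    · exact ⟨0, zero_mem _, _, Submodule.subset_span ⟨p, rfl⟩, 0, zero_mem _, 0, zero_mem _,
        by simp [mkGen]⟩
    · exact ⟨0, zero_mem _, 0, zero_mem _, 0, zero_mem _, _, Submodule.subset_span ⟨p, rfl⟩,
        by simp [mkGen]⟩

theorem mk_skew_add (X Y : Matrix (Fin n) (Fin n) ℝ) :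
    skewPart (X + Y) = skewPart X + skewPart Y := by
  simp only [skewPart, Matrix.transpose_add, ← smul_add]; congr 1; abel

theorem mk_skew_comm {M : Matrix (Fin n) (Fin n) ℝ} (hM : Mᵀ = -M) (X : Matrix (Fin n) (Fin n) ℝ) :
    skewPart (M * X - X * M) = M * skewPart X - skewPart X * M := by
  simp only [skewPart, Matrix.transpose_sub, Matrix.transpose_mul, hM, Matrix.mul_smul,
    Matrix.smul_mul, ← smul_sub, Matrix.mul_sub, Matrix.sub_mul, Matrix.mul_neg, Matrix.neg_mul]
  congr 1; abel

theorem mk_skew_skew (X : Matrix (Fin n) (Fin n) ℝ) : (skewPart X)ᵀ = - skewPart X := by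
  ext i j; simp [skewPart]; ring

theorem mk_skew_self {X : Matrix (Fin n) (Fin n) ℝ} (hX : Xᵀ = -X) : skewPart X = X := by
  ext i j; simp [skewPart, hX]; ring

theorem mk_six {a b c p q : Matrix (Fin n) (Fin n) ℝ} (T1 : (a * p).trace = 0)
    (T2 : (b * p).trace = 0) (T3 : (c * p).trace = 0) (T4 : (a * q).trace = 0)
    (T5 : (b * q).trace = 0) (T6 : (c * q).trace = 0) : ((a - b - c) * (p + q)).trace = 0 := by
  simp only [Matrix.sub_mul, Matrix.mul_add, Matrix.trace_sub, Matrix.trace_add, T1, T2, T3, T4,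
    T5, T6]
  simp

theorem mk_conclude {α : Fin r → ℝ} {A M : Matrix (Fin n) (Fin n) ℝ}
    (hA : A = Matrix.diagonal fun i => α (blk i)) (hM : M ∈ pSet blk l)
    (htop : mkOm blk l A Finset.univ M = ⊤)
    {η : Matrix (Fin n) (Fin n) ℝ} (hη : η ∈ jSet blk l M)
    (hF : ∀ ξ ∈ Submodule.span ℝ (pManakovGradients blk l A M),
      (M * (ξ * η - η * ξ)).trace = 0) :
    η ∈ Submodule.span ℝ (pManakovGradients blk l A M) ⊔ Submodule.span ℝ (kSet blk l) := by
  obtain ⟨hMs, hMp⟩ := hM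
  obtain ⟨⟨hηs, hηp⟩, hηj⟩ := hη
  have hAt : Aᵀ = A := by rw [hA]; simp
  obtain ⟨c, hc, P, hP, x, hx, Q, hQ, hdec⟩ := mkOm_decomp (by rw [htop]; trivial : η ∈ mkOm blk l A Finset.univ M)
  have hP' := mkL_skew hMs hAt hP
  have hQ' := mkL_skew hMs hAt hQ
  have hPb : ∀ a b, blk a = blk b → (M * skewPart P - skewPart P * M) a b = 0 := by
    rw [hA] at hP'
    exact mkL_blk hP'
  have hQb : ∀ a b, blk a = blk b → (M * skewPart Q - skewPart Q * M) a b = 0 := by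
    rw [hA] at hQ'
    exact mkL_blk hQ'
  have hx0 : ∀ a b, ¬(blk a = blk b ∧ (blk a : ℕ) < l) → skewPart x a b = 0 := by
    intro a b hab
    have h1 := hx a b hab
    have h2 := hx b a (by rintro ⟨h, h'⟩; exact hab ⟨h.symm, h ▸ h'⟩)
    simp [skewPart, h1, h2]
  have hxh : skewPart x ∈ hSet blk l := ⟨mk_skew_skew x, hx0⟩
  -- block diagonal parts
  have hpart : ∀ Y : Matrix (Fin n) (Fin n) ℝ, Yᵀ = -Y →
      ∃ y ∈ hSet blk l, Y = projP blk l Y + y := by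
    intro Y hY
    refine ⟨Y - projP blk l Y, ⟨?_, ?_⟩, by abel⟩
    · ext a b
      have hh : Y b a = - Y a b := congrFun (congrFun hY a) b
      simp only [Matrix.transpose_apply, Matrix.sub_apply, projP, Matrix.of_apply, Matrix.neg_apply]
      by_cases h : blk a = blk b
      · by_cases h' : (blk b : ℕ) < l <;> simp [h, h', hh]
      · simp [h, Ne.symm h]
    · intro a b hab
      simp [projP, hab]
  obtain ⟨y1, hy1, hPy⟩ := hpart _ (mk_skew_skew P)
  obtain ⟨y2, hy2, hQy⟩ := hpart _ (mk_skew_skew Q)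
  set f := projP blk l (skewPart P) with hf
  set ξ := projP blk l (skewPart Q) with hξ
  have hfG : f ∈ Submodule.span ℝ (pManakovGradients blk l A M) := mkL_grad hP
  have hξG : ξ ∈ Submodule.span ℝ (pManakovGradients blk l A M) := mkL_grad hQ
  set κ := projP blk l (skewPart c) with hκ
  have hκk : κ ∈ kSet blk l := by
    have h0 : ∀ a b, ¬(blk a = blk b ∧ l ≤ (blk a : ℕ)) → κ a b = 0 := by
      intro a b hab
      simp only [hκ, projP, Matrix.of_apply]
      by_cases h : blk a = blk b
      · have : (blk a : ℕ) < l := by by_contra h'; exact hab ⟨h, not_lt.1 h'⟩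
        rw [if_pos ⟨h, this⟩]
      · simp [skewPart, hc a (Finset.mem_univ _) b (Finset.mem_univ _) h]
    refine ⟨?_, h0⟩
    ext a b
    have hh : skewPart c b a = - skewPart c a b := congrFun (congrFun (mk_skew_skew c) a) b
    simp only [Matrix.transpose_apply, hκ, projP, Matrix.of_apply, Matrix.neg_apply]
    by_cases h : blk a = blk b
    · by_cases h' : (blk b : ℕ) < l <;> simp [h, h', hh]
    · simp [h, Ne.symm h, hh]
  set ζ := skewPart x + skewPart Q with hζ
  set ω := M * ζ - ζ * M with hω
  have hhM : ∀ y : Matrix (Fin n) (Fin n) ℝ, (∀ a b, ¬(blk a = blk b ∧ (blk a : ℕ) < l) → y a b = 0) → ∀ a b, blk a = blk b →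
      (blk a : ℕ) < l → (M * y - y * M) a b = 0 := by
    intro y hy a b hab hal
    simp only [Matrix.sub_apply, Matrix.mul_apply]
    rw [Finset.sum_eq_zero, Finset.sum_eq_zero, sub_zero]
    · intro e _
      by_cases h : blk a = blk e ∧ (blk a : ℕ) < l
      · rw [hMp e b (h.1.symm.trans hab) (h.1 ▸ h.2), mul_zero]
      · rw [hy a e h, zero_mul]
    · intro e _
      by_cases h : blk e = blk b ∧ (blk e : ℕ) < l
      · rw [hMp a e (hab.trans h.1.symm) hal, zero_mul]
      · rw [hy e b h, mul_zero]
  have hωp : ∀ a b, blk a = blk b → (blk a : ℕ) < l → ω a b = 0 := by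
    intro a b hab hal
    have : ω = (M * skewPart x - skewPart x * M) + (M * skewPart Q - skewPart Q * M) := by
      rw [hω, hζ, Matrix.mul_add, Matrix.add_mul]; abel
    rw [this, Matrix.add_apply, hQb a b hab, hhM _ hx0 a b hab hal, add_zero]
  have hηdec : η = κ + f + ω := by
    have h1 : η = skewPart c + skewPart P + ω := by
      conv_lhs => rw [← mk_skew_self hηs, hdec, mk_skew_add, mk_skew_add, mk_skew_comm hMs,
        mk_skew_add x Q]
    ext a b
    by_cases h : blk a = blk b ∧ (blk a : ℕ) < l
    · simp [hκ, hf, projP, h.1, h.2, hωp a b h.1 h.2, hηp a b h.1 h.2, h.1 ▸ h.2]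
    · rw [h1]
      simp [hκ, hf, projP, h]
  have hωs : ωᵀ = -ω := by
    have : ζᵀ = -ζ := by rw [hζ, Matrix.transpose_add, mk_skew_skew, mk_skew_skew]; abel
    rw [hω, Matrix.transpose_sub, Matrix.transpose_mul, Matrix.transpose_mul, this, hMs]
    simp
  have hωη : ω = η - κ - f := by rw [hηdec]; abel
  -- the six traces
  have T1 : ((M * η - η * M) * skewPart x).trace = 0 := hηj _ hxh
  have T2 : ((M * κ - κ * M) * skewPart x).trace = 0 := by
    rw [mk_trace_comm, neg_eq_zero]
    apply mk_trace_zero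
    intro a b
    by_cases h : blk a = blk b ∧ l ≤ (blk a : ℕ)
    · right
      simp only [Matrix.sub_apply, Matrix.mul_apply]
      rw [Finset.sum_eq_zero, Finset.sum_eq_zero, sub_zero]
      · intro e _
        rw [hx0 b e, zero_mul]
        rintro ⟨_, h'⟩
        rw [← h.1] at h'
        omega
      · intro e _
        rw [hx0 e a, mul_zero]
        rintro ⟨h'', h'⟩
        rw [h''] at h'
        omega
    · left; exact hκk.2 a b h
  have T3 : ((M * f - f * M) * skewPart x).trace = 0 := by
    apply mk_trace_zero
    intro a b
    by_cases h : blk b = blk a ∧ (blk b : ℕ) < l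
    · left
      have : f = skewPart P - y1 := by rw [hPy]; abel
      have : M * f - f * M = (M * skewPart P - skewPart P * M) - (M * y1 - y1 * M) := by
        rw [this, Matrix.mul_sub, Matrix.sub_mul]; abel
      rw [this, Matrix.sub_apply, hPb a b h.1.symm, hhM y1 hy1.2 a b h.1.symm (h.1 ▸ h.2), sub_zero]
    · right; exact hx0 b a h
  have T4 : ((M * η - η * M) * skewPart Q).trace = 0 := by
    rw [hQy, Matrix.mul_add, Matrix.trace_add, hηj y2 hy2, add_zero]
    have h1 := hF ξ hξG
    have h2 : (M * (ξ * η)).trace = (η * (M * ξ)).trace := by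
      rw [← Matrix.mul_assoc, Matrix.trace_mul_comm]
    rw [Matrix.mul_sub, Matrix.trace_sub, h2] at h1
    rw [Matrix.sub_mul, Matrix.trace_sub, Matrix.mul_assoc, Matrix.mul_assoc]
    linarith
  have T5 : ((M * κ - κ * M) * skewPart Q).trace = 0 := by
    rw [mk_trace_comm, neg_eq_zero]
    apply mk_trace_zero
    intro a b
    by_cases h : blk a = blk b
    · right; exact hQb b a h.symm
    · left; exact hκk.2 a b (fun h' => h h'.1)
  have T6 : ((M * f - f * M) * skewPart Q).trace = 0 := by
    rw [mk_trace_comm, neg_eq_zero]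
    have : f = skewPart P - y1 := by rw [hPy]; abel
    rw [this, Matrix.sub_mul, Matrix.trace_sub, mkL_invol hP' hQ', zero_sub, neg_eq_zero]
    apply mk_trace_zero
    intro a b
    by_cases h : blk a = blk b
    · right; exact hQb b a h.symm
    · left; exact hy1.2 a b (fun h' => h h'.1)
  have Tω : (ω * ω).trace = 0 := by
    have h1 := mk_trace_comm M ω ζ
    rw [← hω] at h1
    have h2 : M * ω - ω * M = (M * η - η * M) - (M * κ - κ * M) - (M * f - f * M) := by
      rw [hωη]; simp only [Matrix.mul_sub, Matrix.sub_mul]; abel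
    have h3 := mk_six T1 T2 T3 T4 T5 T6
    rw [← h2, ← hζ, h1] at h3
    linarith
  have hω0 : ω = 0 := by
    have h1 : (ω * ω).trace = -∑ a, ∑ b, (ω a b) ^ 2 := by
      simp only [Matrix.trace, Matrix.diag, Matrix.mul_apply, ← Finset.sum_neg_distrib]
      refine Finset.sum_congr rfl fun a _ => Finset.sum_congr rfl fun b _ => ?_
      have : ω b a = - ω a b := congrFun (congrFun hωs a) b
      rw [this]; ring
    have h3 : ∑ a, ∑ b, (ω a b) ^ 2 = 0 := by linarith
    ext a b
    have h2 := (Finset.sum_eq_zero_iff_of_nonneg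
      (fun a _ => Finset.sum_nonneg fun b _ => sq_nonneg (ω a b))).1 h3 a (Finset.mem_univ _)
    have h4 := (Finset.sum_eq_zero_iff_of_nonneg
      (fun b _ => sq_nonneg (ω a b))).1 h2 b (Finset.mem_univ _)
    simpa using h4
  rw [hηdec, hω0, add_zero, add_comm]
  exact Submodule.add_mem_sup hfG (Submodule.subset_span hκk)

end mkFinal


section mkStep
variable {n r : ℕ}

/-- difference quotients of powers -/
def mkq (X B : Matrix (Fin n) (Fin n) ℝ) : ℕ → ℝ → Matrix (Fin n) (Fin n) ℝ
  | 0, _ => 0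
  | j + 1, s => mkq X B j s * (X + s • B) + X ^ j * B

theorem mkq_spec (X B : Matrix (Fin n) (Fin n) ℝ) (j : ℕ) (s : ℝ) :
    (X + s • B) ^ j = X ^ j + s • mkq X B j s := by
  induction j with
  | zero => simp [mkq]
  | succ j ih =>
    rw [pow_succ, ih, mkq, pow_succ X]
    simp only [Matrix.add_mul, Matrix.mul_add, Matrix.smul_mul, Matrix.mul_smul, smul_add]
    abel

theorem mkq_cont (X B : Matrix (Fin n) (Fin n) ℝ) (j : ℕ) : Continuous (mkq X B j) := by
  induction j with
  | zero => exact continuous_const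
  | succ j ih =>
    show Continuous fun s => mkq X B j s * (X + s • B) + X ^ j * B
    fun_prop

theorem mkq_comm (X B : Matrix (Fin n) (Fin n) ℝ) (j : ℕ) :
    X * mkq X B j 0 - mkq X B j 0 * X = X ^ j * B - B * X ^ j := by
  induction j with
  | zero => simp [mkq]
  | succ j ih =>
    simp only [mkq, zero_smul, add_zero]
    have h1 : X * mkq X B j 0 = mkq X B j 0 * X + (X ^ j * B - B * X ^ j) := by
      rw [← ih]; abel
    have h2 : X ^ j * X = X * X ^ j := by rw [← pow_succ, pow_succ']
    rw [Matrix.mul_add, ← Matrix.mul_assoc X (mkq X B j 0) X, h1, pow_succ']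
    simp only [Matrix.add_mul, Matrix.sub_mul, Matrix.mul_assoc, h2]
    abel

/-- difference quotient of a polynomial -/
noncomputable def mkqf (X B : Matrix (Fin n) (Fin n) ℝ) (f : Polynomial ℝ) (s : ℝ) :
    Matrix (Fin n) (Fin n) ℝ :=
  ∑ j ∈ Finset.range (f.natDegree + 1), f.coeff j • mkq X B j s

theorem mkqf_spec (X B : Matrix (Fin n) (Fin n) ℝ) (f : Polynomial ℝ) (s : ℝ) :
    Polynomial.aeval (X + s • B) f = Polynomial.aeval X f + s • mkqf X B f s := by
  rw [Polynomial.aeval_eq_sum_range, Polynomial.aeval_eq_sum_range, mkqf, Finset.smul_sum,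
    ← Finset.sum_add_distrib]
  refine Finset.sum_congr rfl fun j _ => ?_
  rw [mkq_spec, smul_add, smul_comm]

theorem mkqf_cont (X B : Matrix (Fin n) (Fin n) ℝ) (f : Polynomial ℝ) : Continuous (mkqf X B f) := by
  unfold mkqf
  have := mkq_cont X B
  fun_prop

theorem mkqf_comm (X B : Matrix (Fin n) (Fin n) ℝ) (f : Polynomial ℝ) :
    X * mkqf X B f 0 - mkqf X B f 0 * X =
      Polynomial.aeval X f * B - B * Polynomial.aeval X f := by
  rw [Polynomial.aeval_eq_sum_range, mkqf, Finset.mul_sum, Finset.sum_mul, Finset.mul_sum,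
    Finset.sum_mul, ← Finset.sum_sub_distrib, ← Finset.sum_sub_distrib]
  refine Finset.sum_congr rfl fun j _ => ?_
  rw [Matrix.mul_smul, Matrix.smul_mul, Matrix.smul_mul, Matrix.mul_smul, ← smul_sub, ← smul_sub,
    mkq_comm]

/-- column matrix -/
def mkR (v : Fin n) : (Fin n → ℝ) →ₗ[ℝ] Matrix (Fin n) (Fin n) ℝ where
  toFun y := Matrix.of fun a c => if c = v then y a else 0
  map_add' x y := by ext a c; by_cases h : c = v <;> simp [h]
  map_smul' t y := by ext a c; by_cases h : c = v <;> simp [h]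

theorem mkR_apply (v : Fin n) (y : Fin n → ℝ) (a c : Fin n) :
    mkR v y a c = if c = v then y a else 0 := rfl

def mkB (v : Fin n) (b : Fin n → ℝ) : Matrix (Fin n) (Fin n) ℝ :=
  Matrix.of fun a c => if c = v then b a else if a = v then - b c else 0

variable (blk : Fin n → Fin r) (l : ℕ) (α : Fin r → ℝ)

/-- the reduced matrix -/
def mkG (S : Finset (Fin n)) (i : Fin r) (M : Matrix (Fin n) (Fin n) ℝ) (t : ℝ) :
    Matrix (Fin n) (Fin n) ℝ :=
  Matrix.diagonal (fun a => if a ∈ S then t * (α i - α (blk a)) else 1) - M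

noncomputable def mkV (S : Finset (Fin n)) (i : Fin r) (b : Fin n → ℝ) (t : ℝ)
    (M : Matrix (Fin n) (Fin n) ℝ) : Fin n → ℝ :=
  (mkG blk α S i M t).det • ((mkG blk α S i M t).adjugate *ᵥ b
    + (mkG blk α S i M t)ᵀ.adjugate *ᵥ b)

abbrev MkQIdx (S : Finset (Fin n)) (i : Fin r) :=
  {z : Fin n // z ∉ S ∨ blk z = i} ⊕ {z : Fin n // blk z = i ∧ (i : ℕ) < l} ⊕ ℝ ⊕ ℝ

noncomputable def mkQGen (S : Finset (Fin n)) (i : Fin r) (b : Fin n → ℝ) (k : MkQIdx blk l S i)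
    (M : Matrix (Fin n) (Fin n) ℝ) : Fin n → ℝ :=
  match k with
  | .inl z => Pi.single z.1 1
  | .inr (.inl z) => M *ᵥ Pi.single z.1 1
  | .inr (.inr (.inl t)) => mkV blk α S i b t M
  | .inr (.inr (.inr t)) => M *ᵥ mkV blk α S i b t M

noncomputable def mkQ (S : Finset (Fin n)) (i : Fin r) (b : Fin n → ℝ)
    (M : Matrix (Fin n) (Fin n) ℝ) : Submodule ℝ (Fin n → ℝ) :=
  Submodule.span ℝ (Set.range fun k => mkQGen blk l α S i b k M)

variable {blk l α}

theorem mkQ_open (S : Finset (Fin n)) (i : Fin r) (b : Fin n → ℝ) (M : Matrix (Fin n) (Fin n) ℝ)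
    (h : mkQ blk l α S i b M = ⊤) : ∀ᶠ M' in nhds M, mkQ blk l α S i b M' = ⊤ := by
  obtain ⟨c, hc⟩ := mk_span_open (Pi.basisFun ℝ (Fin n))
    (fun k M => mkQGen blk l α S i b k M) M (by
      intro k a
      have hG : ∀ t, Continuous fun M => mkG blk α S i M t := by
        intro t; unfold mkG; fun_prop
      have hV : ∀ t, Continuous fun M => mkV blk α S i b t M := by
        intro t; unfold mkV
        have := hG t
        exact (this.matrix_det).smul (((this.matrix_adjugate).matrix_mulVec continuous_const).add
          ((this.matrix_transpose.matrix_adjugate).matrix_mulVec continuous_const))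
      have : Continuous fun M => mkQGen blk l α S i b k M := by
        rcases k with z | z | t | t <;> simp only [mkQGen]
        · fun_prop
        · exact continuous_id.matrix_mulVec continuous_const
        · exact hV t
        · exact continuous_id.matrix_mulVec (hV t)
      simpa [Function.comp_def] using (continuous_apply a).comp this) h
  filter_upwards [hc] with M' hM'
  rw [eq_top_iff, ← hM']
  apply Submodule.span_mono
  rintro _ ⟨a, rfl⟩
  exact ⟨c a, rfl⟩

end mkStep


section mkStep2
variable {n r : ℕ} {blk : Fin n → Fin r} {l : ℕ} {α : Fin r → ℝ}

theorem mkAdm_col {S : Finset (Fin n)} {M : Matrix (Fin n) (Fin n) ℝ} (hM : M ∈ mkAdm blk l S)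
    (a c : Fin n) (hc : c ∉ S) : M a c = 0 := by
  have : M c a = - M a c := congrFun (congrFun hM.1 a) c
  rw [hM.2.2 c a hc] at this
  linarith

variable (blk α) in
/-- the annihilating polynomial -/
noncomputable def mkf (S : Finset (Fin n)) (i : Fin r) (M : Matrix (Fin n) (Fin n) ℝ) (t : ℝ) :
    Polynomial ℝ :=
  (Matrix.scalar (Fin n) (t * α i) - mkG blk α S i M t).charpoly

theorem mkf_eval (S : Finset (Fin n)) (i : Fin r) (M : Matrix (Fin n) (Fin n) ℝ) (t : ℝ) :
    (mkf blk α S i M t).eval (t * α i) = (mkG blk α S i M t).det := by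
  rw [mkf, Matrix.eval_charpoly]
  congr 1
  abel

theorem mkF_apply {S : Finset (Fin n)} (i : Fin r) {M : Matrix (Fin n) (Fin n) ℝ}
    (hM : M ∈ mkAdm blk l S) (t : ℝ) (a c : Fin n) :
    Polynomial.aeval (M + t • Matrix.diagonal fun i => α (blk i)) (mkf blk α S i M t) a c =
      if a = c ∧ c ∉ S then (mkf blk α S i M t).eval (t * α (blk c)) else 0 := by
  set X := M + t • Matrix.diagonal fun i => α (blk i) with hX
  set f := mkf blk α S i M t with hf
  by_cases hc : c ∈ S
  · rw [if_neg (by simp [hc])]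
    set Xt := Matrix.scalar (Fin n) (t * α i) - mkG blk α S i M t with hXt
    have hCH : Polynomial.aeval Xt f = 0 := Matrix.aeval_self_charpoly Xt
    -- the projection
    let E : Matrix (Fin n) (Fin n) ℝ := Matrix.diagonal fun a => if a ∈ S then 1 else 0
    have e1 : X * E = Xt * E := by
      ext a c
      simp only [E, Matrix.mul_diagonal]
      by_cases h : c ∈ S
      · by_cases hac : a = c
        · subst hac
          simp [hX, hXt, mkG, h]; ring
        · simp [hX, hXt, mkG, h, hac]
      · simp [h]
    have e2 : Xt * E = E * Xt := by
      ext a c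
      simp only [E, Matrix.mul_diagonal, Matrix.diagonal_mul]
      by_cases hac : a = c
      · subst hac; ring
      · by_cases h : c ∈ S <;> by_cases h' : a ∈ S
        · simp [h, h']
        · simp [h, h', hXt, mkG, hac, hM.2.2 a c h']
        · simp [h, h', hXt, mkG, hac, mkAdm_col hM a c h]
        · simp [h, h']
    have e3 : ∀ j, Xt ^ j * E = E * Xt ^ j := fun j => ((show Commute Xt E from e2).pow_left j).eq
    have e4 : ∀ j, X ^ j * E = Xt ^ j * E := by
      intro j
      induction j with
      | zero => simp
      | succ j ih =>
        rw [pow_succ', Matrix.mul_assoc, ih, e3, ← Matrix.mul_assoc, e1, Matrix.mul_assoc, ← e3,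
          ← Matrix.mul_assoc, ← pow_succ']
    have e5 : Polynomial.aeval X f * E = Polynomial.aeval Xt f * E := by
      rw [Polynomial.aeval_eq_sum_range, Polynomial.aeval_eq_sum_range, Finset.sum_mul,
        Finset.sum_mul]
      refine Finset.sum_congr rfl fun j _ => ?_
      rw [Matrix.smul_mul, Matrix.smul_mul, e4]
    rw [hCH, Matrix.zero_mul] at e5
    have := congrFun (congrFun e5 a) c
    simpa [E, Matrix.mul_diagonal, hc] using this
  · have hp : ∀ j, (X ^ j) a c = if a = c then (t * α (blk c)) ^ j else 0 := by
      intro j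
      induction j with
      | zero => simp [Matrix.one_apply]
      | succ j ih =>
        rw [pow_succ, Matrix.mul_apply, Finset.sum_eq_single c]
        · rw [ih]
          have : X c c = t * α (blk c) := by simp [hX, mkAdm_col hM c c hc]
          rw [this]
          split_ifs
          · rw [pow_succ]
          · simp
        · intro e _ he
          have : X e c = 0 := by simp [hX, mkAdm_col hM e c hc, he]
          rw [this, mul_zero]
        · simp
    rw [Polynomial.aeval_eq_sum_range, Polynomial.eval_eq_sum_range, Matrix.sum_apply]
    simp only [Matrix.smul_apply, hp]
    by_cases h : a = c <;> simp [h, hc]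

/-- the shape of the derivative -/
theorem mkq_shape {X B : Matrix (Fin n) (Fin n) ℝ} {v : Fin n} 
    (hX : ∀ c, c ≠ v → X c v = 0 ∧ X v c = 0) (hB : ∀ a c, a ≠ v → c ≠ v → B a c = 0) (j : ℕ) :
    ∀ a c, a ≠ v → c ≠ v → mkq X B j 0 a c = 0 := by
  induction j with
  | zero => intros; simp [mkq]
  | succ j ih =>
    intro a c ha hc
    have hp : ∀ j a, a ≠ v → (X ^ j) a v = 0 := by
      intro j
      induction j with
      | zero => intro a ha; simp [Matrix.one_apply, ha]
      | succ j ih =>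
        intro a ha
        rw [pow_succ, Matrix.mul_apply]
        refine Finset.sum_eq_zero fun e _ => ?_
        by_cases he : e = v
        · subst he; rw [ih a ha, zero_mul]
        · rw [(hX e he).1, mul_zero]
    simp only [mkq, zero_smul, add_zero, Matrix.add_apply, Matrix.mul_apply]
    rw [Finset.sum_eq_zero, Finset.sum_eq_zero, add_zero]
    · intro e _
      by_cases he : e = v
      · subst he; rw [hp j a ha, zero_mul]
      · rw [hB e c he hc, mul_zero]
    · intro e _
      by_cases he : e = v
      · subst he; rw [(hX c hc).2, mul_zero]
      · rw [ih a e ha he, zero_mul]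

theorem mk_adj {G : Matrix (Fin n) (Fin n) ℝ} {y b : Fin n → ℝ} (hG : G.det ≠ 0)
    (h : G *ᵥ y = G.det • b) : y = G.adjugate *ᵥ b := by
  have h1 := congrArg (fun z => G.adjugate *ᵥ z) h
  simp only [Matrix.mulVec_mulVec, Matrix.adjugate_mul, Matrix.smul_mulVec, Matrix.one_mulVec,
    Matrix.mulVec_smul] at h1
  have := congrArg (fun z => (G.det)⁻¹ • z) h1
  simpa [smul_smul, inv_mul_cancel₀ hG] using this

/-- entries of the derivative -/
theorem mkY_entries {S : Finset (Fin n)} {v : Fin n} (hv : v ∉ S) {M : Matrix (Fin n) (Fin n) ℝ}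
    (hM : M ∈ mkAdm blk l S) {b : Fin n → ℝ} (hb : ∀ a, a ∉ S → b a = 0) (t : ℝ)
    (hdet : (mkG blk α S (blk v) M t).det ≠ 0) (Y : Matrix (Fin n) (Fin n) ℝ)
    (hY : Y = mkqf (M + t • Matrix.diagonal fun i => α (blk i)) (mkB v b)
      (mkf blk α S (blk v) M t) 0) :
    (∀ a c, a ≠ v → c ≠ v → Y a c = 0) ∧
    (∀ a ∈ S, Y a v - Y v a = ((mkG blk α S (blk v) M t).adjugate *ᵥ b
      + (mkG blk α S (blk v) M t)ᵀ.adjugate *ᵥ b) a) := by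
  set X := M + t • Matrix.diagonal fun i => α (blk i) with hX
  set f := mkf blk α S (blk v) M t with hf
  set G := mkG blk α S (blk v) M t with hG
  have hXe : ∀ a c, X a c = M a c + if a = c then t * α (blk c) else 0 := by
    intro a c
    by_cases h : a = c
    · subst h; simp [hX]
    · simp [hX, h]
  have hGe : ∀ a c, G a c = (if a = c then (if c ∈ S then t * (α (blk v) - α (blk c)) else 1) else 0)
      - M a c := by
    intro a c
    by_cases h : a = c
    · subst h; simp [hG, mkG]
    · simp [hG, mkG, h]
  have hF := mkF_apply (α := α) (blk v) hM t
  rw [← hX, ← hf] at hF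
  set F := Polynomial.aeval X f with hFd
  have hFv : F v v = G.det := by rw [hF, if_pos ⟨rfl, hv⟩, hf, mkf_eval]
  have hcomm := mkqf_comm X (mkB v b) f
  rw [← hY, ← hFd] at hcomm
  have hBv : ∀ a, mkB v b a v = b a := by intro a; simp [mkB]
  have hBr : ∀ a, a ≠ v → mkB v b v a = - b a := by intro a ha; simp [mkB, ha]
  refine ⟨?_, ?_⟩
  · intro a c ha hc
    rw [hY, mkqf, Matrix.sum_apply]
    refine Finset.sum_eq_zero fun j _ => ?_
    rw [Matrix.smul_apply, mkq_shape _ _ j a c ha hc, smul_zero]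
    · intro c hc
      rw [hXe, hXe, mkAdm_col hM c v hv, hM.2.2 v c hv]
      simp [hc, Ne.symm hc]
    · intro a c ha hc
      simp [mkB, ha, hc]
  · have hcol : (fun a => if a ∈ S then Y a v else 0) = G.adjugate *ᵥ b := by
      apply mk_adj hdet
      funext a
      rw [Matrix.mulVec, dotProduct]
      by_cases ha : a ∈ S
      · have hav : a ≠ v := fun h => hv (h ▸ ha)
        have h1 := congrFun (congrFun hcomm a) v
        simp only [Matrix.sub_apply, Matrix.mul_apply] at h1
        rw [Finset.sum_eq_single (s := Finset.univ) (f := fun j => Y a j * X j v) v,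
          Finset.sum_eq_zero (f := fun j => F a j * mkB v b j v),
          Finset.sum_eq_single (s := Finset.univ) (f := fun j => mkB v b a j * F j v) v] at h1
        · rw [hXe v v, hM.2.2 v v hv, hFv, hBv] at h1
          simp only [if_true] at h1
          have h2 : ∑ x, G a x * (if x ∈ S then Y x v else 0) =
              t * α (blk v) * Y a v - ∑ x, X a x * Y x v := by
            have : ∀ x, G a x * (if x ∈ S then Y x v else 0) =
               (if x = a then t * α (blk v) * Y a v else 0) - X a x * Y x v := by
              intro x
              rw [hGe, hXe]
              by_cases hx : x ∈ S
              · by_cases hxa : x = a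
                · subst hxa; simp [hx]; ring
                · simp [hx, hxa, Ne.symm hxa]
              · have hxa : x ≠ a := fun h => hx (h ▸ ha)
                simp [hx, hxa, Ne.symm hxa, mkAdm_col hM a x hx]
            rw [Finset.sum_congr rfl fun x _ => this x, Finset.sum_sub_distrib]
            simp
          rw [h2]
          simp only [Pi.smul_apply, smul_eq_mul]
          linarith
        · intro e _ he
          rw [hF]; simp [he]
        · simp
        · intro e _
          rw [hF]
          have : ¬(a = e ∧ e ∉ S) := by rintro ⟨rfl, h⟩; exact h ha
          simp [this]
        · intro e _ he
          rw [hXe, mkAdm_col hM e v hv]; simp [he]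
        · simp
      · rw [Finset.sum_eq_zero]
        · simp [hb a ha]
        · intro e _
          by_cases he : e ∈ S
          · have : a ≠ e := fun h => ha (h ▸ he)
            rw [hGe, hM.2.2 a e ha]; simp [this]
          · simp [he]
    have hrow : (fun a => if a ∈ S then - Y v a else 0) = Gᵀ.adjugate *ᵥ b := by
      apply mk_adj (by rwa [Matrix.det_transpose])
      funext a
      rw [Matrix.mulVec, dotProduct, Matrix.det_transpose]
      simp only [Matrix.transpose_apply]
      by_cases ha : a ∈ S
      · have hav : a ≠ v := fun h => hv (h ▸ ha)
        have h1 := congrFun (congrFun hcomm v) a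
        simp only [Matrix.sub_apply, Matrix.mul_apply] at h1
        rw [Finset.sum_eq_single (s := Finset.univ) (f := fun j => X v j * Y j a) v,
          Finset.sum_eq_zero (f := fun j => mkB v b v j * F j a),
          Finset.sum_eq_single (s := Finset.univ) (f := fun j => F v j * mkB v b j a) v] at h1
        · rw [hXe v v, hM.2.2 v v hv, hFv, hBr a hav] at h1
          simp only [if_true] at h1
          have h2 : ∑ x, G x a * (if x ∈ S then - Y v x else 0) =
              - (t * α (blk v) * Y v a) + ∑ x, Y v x * X x a := by
            have : ∀ x, G x a * (if x ∈ S then - Y v x else 0) =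
               - (if x = a then t * α (blk v) * Y v a else 0) + Y v x * X x a := by
              intro x
              rw [hGe, hXe]
              by_cases hx : x ∈ S
              · by_cases hxa : x = a
                · subst hxa; simp [hx]; ring
                · simp [hx, hxa]; ring
              · have hxa : x ≠ a := fun h => hx (h ▸ ha)
                simp [hx, hxa, hM.2.2 x a hx]
            rw [Finset.sum_congr rfl fun x _ => this x, Finset.sum_add_distrib]
            simp
          rw [h2]
          simp only [Pi.smul_apply, smul_eq_mul]
          linarith
        · intro e _ he
          rw [hF]; simp [Ne.symm he]
        · simp
        · intro e _
          rw [hF]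
          simp [ha]
        · intro e _ he
          rw [hXe, hM.2.2 v e hv]; simp [Ne.symm he]
        · simp
      · rw [Finset.sum_eq_zero]
        · simp [hb a ha]
        · intro e _
          by_cases he : e ∈ S
          · have : e ≠ a := fun h => ha (h ▸ he)
            rw [hGe, mkAdm_col hM e a ha]; simp [this]
          · simp [he]
    intro a ha
    rw [← hcol, ← hrow]
    simp [ha]
    ring

end mkStep2


section mkStep3
variable {n r : ℕ} {blk : Fin n → Fin r} {l : ℕ} {α : Fin r → ℝ}

variable (blk l α) in
/-- the deformed family -/
noncomputable def mkFam (S : Finset (Fin n)) (v : Fin n) (M : Matrix (Fin n) (Fin n) ℝ)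
    (b : Fin n → ℝ) (k : MkIdx blk l (insert v S) ⊕ ℝ ⊕ ℝ) (s : ℝ) : Matrix (Fin n) (Fin n) ℝ :=
  match k with
  | .inl k => mkGen blk l (Matrix.diagonal fun i => α (blk i)) (insert v S) k (M + s • mkB v b)
  | .inr (.inl t) => mkqf (M + t • Matrix.diagonal fun i => α (blk i)) (mkB v b)
      (mkf blk α S (blk v) M t) s
  | .inr (.inr t) =>
    (M + s • mkB v b) * mkqf (M + t • Matrix.diagonal fun i => α (blk i)) (mkB v b)
      (mkf blk α S (blk v) M t) s -
    mkqf (M + t • Matrix.diagonal fun i => α (blk i)) (mkB v b)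
      (mkf blk α S (blk v) M t) s * (M + s • mkB v b)

theorem mkFam_cont (S : Finset (Fin n)) (v : Fin n) (M : Matrix (Fin n) (Fin n) ℝ)
    (b : Fin n → ℝ) (k : MkIdx blk l (insert v S) ⊕ ℝ ⊕ ℝ) :
    Continuous (mkFam blk l α S v M b k) := by
  rcases k with k | t | t
  · exact (mkGen_continuous blk l _ _ k).comp (by fun_prop)
  · exact mkqf_cont _ _ _
  · have := mkqf_cont (M + t • Matrix.diagonal fun i => α (blk i)) (mkB v b)
      (mkf blk α S (blk v) M t)
    show Continuous fun s => _
    simp only [mkFam]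
    fun_prop

theorem mkFam_mem {S : Finset (Fin n)} {v : Fin n} (hv : v ∉ S) {M : Matrix (Fin n) (Fin n) ℝ}
    (hM : M ∈ mkAdm blk l S) {b : Fin n → ℝ} (hb : ∀ a, a ∉ S → b a = 0)
    (k : MkIdx blk l (insert v S) ⊕ ℝ ⊕ ℝ) (s : ℝ) (hs : s ≠ 0) :
    mkFam blk l α S v M b k s ∈
      mkOm blk l (Matrix.diagonal fun i => α (blk i)) (insert v S) (M + s • mkB v b) := by
  set A : Matrix (Fin n) (Fin n) ℝ := Matrix.diagonal fun i => α (blk i) with hA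
  set Ms := M + s • mkB v b with hMs
  have hbv : b v = 0 := hb v hv
  have key : ∀ (t : ℝ) (f : Polynomial ℝ), Polynomial.aeval (Ms + t • A) f ∈ mkOm blk l A (insert v S) Ms ∧
      Ms * Polynomial.aeval (Ms + t • A) f - Polynomial.aeval (Ms + t • A) f * Ms
        ∈ mkOm blk l A (insert v S) Ms := by
    intro t f
    rw [Polynomial.aeval_eq_sum_range, Finset.mul_sum, Finset.sum_mul, ← Finset.sum_sub_distrib]
    constructor
    · refine sum_mem fun j _ => Submodule.smul_mem _ _ (Submodule.subset_span ?_)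
      exact ⟨.inr (.inr (.inl (t, j))), rfl⟩
    · refine sum_mem fun j _ => ?_
      rw [Matrix.mul_smul, Matrix.smul_mul, ← smul_sub]
      refine Submodule.smul_mem _ _ (Submodule.subset_span ?_)
      exact ⟨.inr (.inr (.inr (t, j))), rfl⟩
  have hC : ∀ Z ∈ mkC blk (insert v S), Z ∈ mkOm blk l A (insert v S) Ms := by
    intro Z hZ
    exact Submodule.subset_span ⟨.inl ⟨Z, hZ⟩, rfl⟩
  have hF : ∀ t, Polynomial.aeval (M + t • A) (mkf blk α S (blk v) M t) ∈ mkC blk (insert v S) := by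
    intro t a _ c _ hac
    have hne : a ≠ c := fun h => hac (h ▸ rfl)
    rw [mkF_apply (blk v) hM, mkF_apply (blk v) hM]
    simp [hne, Ne.symm hne]
  have hMse : ∀ a c, Ms a c = M a c + s * (if c = v then b a else if a = v then - b c else 0) := by
    intro a c; simp [hMs, mkB]
  have hFc : ∀ t, Ms * Polynomial.aeval (M + t • A) (mkf blk α S (blk v) M t) -
      Polynomial.aeval (M + t • A) (mkf blk α S (blk v) M t) * Ms ∈ mkC blk (insert v S) := by
    intro t
    have hD : Polynomial.aeval (M + t • A) (mkf blk α S (blk v) M t) =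
        Matrix.diagonal fun c => if c ∉ S then
          (mkf blk α S (blk v) M t).eval (t * α (blk c)) else 0 := by
      ext a c
      rw [mkF_apply (blk v) hM]
      by_cases h : a = c
      · subst h; simp
      · simp [h]
    rw [hD]
    intro a ha c hc hac
    have hne : a ≠ c := fun h => hac (h ▸ rfl)
    simp only [Matrix.sub_apply, Matrix.mul_diagonal, Matrix.diagonal_mul]
    rw [Finset.mem_insert] at ha hc
    rw [hMse, hMse]
    rcases ha with rfl | ha <;> rcases hc with rfl | hc
    · exact absurd rfl hne
    · simp [hv, hc, Ne.symm hne, hM.2.2 a c hv, mkAdm_col hM c a hv]; ring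
    · simp [hv, ha, hne, hM.2.2 c a hv, mkAdm_col hM a c hv]; ring
    · simp [ha, hc]
  have hq : ∀ t, mkqf (M + t • A) (mkB v b) (mkf blk α S (blk v) M t) s =
      s⁻¹ • (Polynomial.aeval (Ms + t • A) (mkf blk α S (blk v) M t) -
        Polynomial.aeval (M + t • A) (mkf blk α S (blk v) M t)) := by
    intro t
    have := mkqf_spec (M + t • A) (mkB v b) (mkf blk α S (blk v) M t) s
    have h2 : M + t • A + s • mkB v b = Ms + t • A := by rw [hMs]; abel
    rw [h2] at this
    rw [this, add_sub_cancel_left, smul_smul, inv_mul_cancel₀ hs, one_smul]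
  rcases k with k | t | t
  · exact Submodule.subset_span ⟨k, rfl⟩
  · show mkqf (M + t • A) (mkB v b) (mkf blk α S (blk v) M t) s ∈ _
    rw [hq]
    exact Submodule.smul_mem _ _ (sub_mem (key t _).1 (hC _ (hF t)))
  · show Ms * mkqf (M + t • A) (mkB v b) (mkf blk α S (blk v) M t) s -
      mkqf (M + t • A) (mkB v b) (mkf blk α S (blk v) M t) s * Ms ∈ _
    rw [hq, Matrix.mul_smul, Matrix.smul_mul, ← smul_sub]
    apply Submodule.smul_mem
    have h3 := sub_mem (key t (mkf blk α S (blk v) M t)).2 (hC _ (hFc t))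
    convert h3 using 1
    rw [Matrix.mul_sub, Matrix.sub_mul]
    abel

theorem mkFam_top {S : Finset (Fin n)} {v : Fin n} (hv : v ∉ S) {M : Matrix (Fin n) (Fin n) ℝ}
    (hM : M ∈ mkAdm blk l S) {b : Fin n → ℝ} (hb : ∀ a, a ∉ S → b a = 0)
    (hOm : mkOm blk l (Matrix.diagonal fun i => α (blk i)) S M = ⊤)
    (hQ : mkQ blk l α S (blk v) b M = ⊤) :
    Submodule.span ℝ (Set.range fun k => mkFam blk l α S v M b k 0) = ⊤ := by
  set A : Matrix (Fin n) (Fin n) ℝ := Matrix.diagonal fun i => α (blk i) with hA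
  set N := Submodule.span ℝ (Set.range fun k => mkFam blk l α S v M b k 0) with hN
  have hgen : ∀ k, mkFam blk l α S v M b k 0 ∈ N := fun k => Submodule.subset_span ⟨k, rfl⟩
  have hgen' : ∀ k, mkGen blk l A (insert v S) k M ∈ N := by
    intro k
    have := hgen (.inl k)
    simpa [mkFam] using this
  have hC : ∀ Z ∈ mkC blk (insert v S), Z ∈ N := by
    intro Z hZ
    exact hgen' (.inl ⟨Z, hZ⟩)
  -- the derivative gives columns
  have hYV : ∀ t, (mkR v (mkV blk α S (blk v) b t M) ∈ N ∧
      mkR v (M *ᵥ mkV blk α S (blk v) b t M) ∈ N) := by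
    intro t
    by_cases hdet : (mkG blk α S (blk v) M t).det = 0
    · simp [mkV, hdet]
    obtain ⟨Y, hY⟩ : ∃ Y, Y = mkqf (M + t • A) (mkB v b) (mkf blk α S (blk v) M t) 0 := ⟨_, rfl⟩
    obtain ⟨h0, h1⟩ := mkY_entries hv hM hb t hdet Y hY
    obtain ⟨W, hW⟩ : ∃ W, W = ((mkG blk α S (blk v) M t).adjugate *ᵥ b
      + (mkG blk α S (blk v) M t)ᵀ.adjugate *ᵥ b) := ⟨_, rfl⟩
    rw [← hW] at h1
    have hVW : mkV blk α S (blk v) b t M = (mkG blk α S (blk v) M t).det • W := by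
      rw [hW]; rfl
    have hYN : Y ∈ N := by
      have := hgen (.inr (.inl t))
      rw [hY]
      simpa [mkFam] using this
    have hYN2 : M * Y - Y * M ∈ N := by
      have := hgen (.inr (.inr t))
      rw [hY]
      simpa [mkFam] using this
    rw [hVW, Matrix.mulVec_smul, map_smul, map_smul]
    constructor
    · apply Submodule.smul_mem
      have h2 : mkR v W - Y ∈ mkC blk (insert v S) := by
        intro a ha c hc hac
        have hne : a ≠ c := fun h => hac (h ▸ rfl)
        simp only [Matrix.sub_apply, mkR_apply]
        rw [Finset.mem_insert] at ha hc
        rcases ha with rfl | ha <;> rcases hc with rfl | hc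
        · exact absurd rfl hne
        · have := h1 c hc
          simp [Ne.symm hne]; linarith
        · have := h1 a ha
          simp [hne]; linarith
        · have hav : a ≠ v := fun h => hv (h ▸ ha)
          have hcv : c ≠ v := fun h => hv (h ▸ hc)
          simp [hav, hcv, h0 a c hav hcv, h0 c a hcv hav]
      have := add_mem (hC _ h2) hYN
      simpa using this
    · apply Submodule.smul_mem
      have e1 : ∀ a c, a ≠ v → c ≠ v → (M * Y - Y * M) a c = 0 := by
        intro a c ha hc
        simp only [Matrix.sub_apply, Matrix.mul_apply]
        rw [Finset.sum_eq_zero, Finset.sum_eq_zero, sub_zero]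
        · intro e _
          by_cases he : e = v
          · subst he; rw [hM.2.2 e c hv, mul_zero]
          · rw [h0 a e ha he, zero_mul]
        · intro e _
          by_cases he : e = v
          · subst he; rw [mkAdm_col hM a e hv, zero_mul]
          · rw [h0 e c he hc, mul_zero]
      have e2 : ∀ a, a ≠ v → (M * Y - Y * M) a v - (M * Y - Y * M) v a = (M *ᵥ W) a := by
        intro a ha
        simp only [Matrix.sub_apply, Matrix.mul_apply, Matrix.mulVec, dotProduct]
        rw [Finset.sum_eq_zero (f := fun j => Y a j * M j v),
          Finset.sum_eq_zero (f := fun j => M v j * Y j a), sub_zero, zero_sub, sub_neg_eq_add,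
          ← Finset.sum_add_distrib]
        · refine Finset.sum_congr rfl fun e _ => ?_
          have hsk : M e a = - M a e := congrFun (congrFun hM.1 a) e
          by_cases he : e ∈ S
          · rw [hsk, ← h1 e he]; ring
          · rw [hM.2.2 e a he, mkAdm_col hM a e he]; ring
        · intro e _; rw [hM.2.2 v e hv, zero_mul]
        · intro e _; rw [mkAdm_col hM e v hv, mul_zero]
      have h2 : mkR v (M *ᵥ W) - (M * Y - Y * M) ∈ mkC blk (insert v S) := by
        intro a ha c hc hac
        have hne : a ≠ c := fun h => hac (h ▸ rfl)
        rw [Matrix.sub_apply _ (M * Y - Y * M) a c, Matrix.sub_apply _ (M * Y - Y * M) c a,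
          mkR_apply, mkR_apply]
        rw [Finset.mem_insert] at ha hc
        by_cases hav : a = v
        · have := e2 c (hav ▸ Ne.symm hne)
          subst hav
          rw [if_neg (Ne.symm hne), if_pos rfl]; linarith
        · by_cases hcv : c = v
          · have := e2 a hav
            subst hcv
            rw [if_pos rfl, if_neg hav]; linarith
          · rw [e1 a c hav hcv, e1 c a hcv hav, if_neg hav, if_neg hcv]
      have := add_mem (hC _ h2) hYN2
      rwa [sub_add_cancel] at this
  have hcol : ∀ y, mkR v y ∈ N := by
    intro y
    have hy : y ∈ mkQ blk l α S (blk v) b M := by rw [hQ]; trivial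
    have hle : mkQ blk l α S (blk v) b M ≤ N.comap (mkR v) := by
      apply Submodule.span_le.2
      rintro _ ⟨k, rfl⟩
      rcases k with ⟨z, hz⟩ | ⟨z, hz⟩ | t | t
      · apply hC
        have hz' : z ∈ insert v S → blk z = blk v := by
          intro h
          rw [Finset.mem_insert] at h
          rcases h with rfl | h
          · rfl
          · rcases hz with hz | hz
            · exact absurd h hz
            · exact hz
        intro a ha c hc hac
        simp only [mkQGen, mkR_apply, Pi.single_apply]
        by_cases haz : a = z
        · subst haz
          have h1 := hz' ha
          have hcv : c ≠ v := by rintro rfl; exact hac h1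
          have hca : c ≠ a := by rintro rfl; exact hac rfl
          simp [hcv, hca]
        · by_cases hcz : c = z
          · subst hcz
            have h1 := hz' hc
            have hcv : a ≠ v := by rintro rfl; exact hac h1.symm
            simp [hcv, haz]
          · simp [haz, hcz]
      · have h1 : Matrix.of (fun a c => if a = z ∧ c = v then (1 : ℝ) else 0) ∈ mkH blk l := by
          intro a c hac
          have : ¬(a = z ∧ c = v) := by
            rintro ⟨rfl, rfl⟩
            exact hac ⟨hz.1, by rw [hz.1]; exact hz.2⟩
          simp [this]
        have h2 := hgen' (.inr (.inl ⟨_, h1⟩))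
        simp only [mkGen] at h2
        show mkR v (M *ᵥ Pi.single z 1) ∈ N
        convert h2 using 1
        ext a c
        rw [Matrix.sub_apply, Matrix.mul_apply, Matrix.mul_apply,
          Finset.sum_eq_zero (f := fun j => Matrix.of (fun a c => if a = z ∧ c = v then (1 : ℝ) else 0) a j * M j c)]
        · simp only [mkR_apply, Matrix.of_apply]
          by_cases hc : c = v <;> simp [hc]
        · intro e _
          by_cases he : e = v
          · subst he; rw [hM.2.2 e c hv, mul_zero]
          · simp [he]
      · exact (hYV t).1
      · exact (hYV t).2
    exact hle hy
  rw [eq_top_iff, ← hOm]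
  apply Submodule.span_le.2
  rintro _ ⟨k, rfl⟩
  rcases k with X | X | p | p
  · have h1 : X.1 - mkR v (fun a => X.1 a v - X.1 v a) ∈ mkC blk (insert v S) := by
      intro a ha c hc hac
      have hne : a ≠ c := fun h => hac (h ▸ rfl)
      simp only [Matrix.sub_apply, mkR_apply]
      rw [Finset.mem_insert] at ha hc
      by_cases hav : a = v
      · subst hav
        rw [if_neg (Ne.symm hne), if_pos rfl]; ring
      · by_cases hcv : c = v
        · subst hcv
          rw [if_pos rfl, if_neg hav]; ring
        · rw [if_neg hav, if_neg hcv, X.2 a (ha.resolve_left hav) c (hc.resolve_left hcv) hac]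
    have := add_mem (hC _ h1) (hcol (fun a => X.1 a v - X.1 v a))
    rwa [sub_add_cancel] at this
  · exact hgen' (.inr (.inl X))
  · exact hgen' (.inr (.inr (.inl p)))
  · exact hgen' (.inr (.inr (.inr p)))

theorem mkB_adm {S : Finset (Fin n)} {v : Fin n} (hv : v ∉ S) {b : Fin n → ℝ}
    (hb : ∀ a, a ∉ S → b a = 0) (hbi : (blk v : ℕ) < l → ∀ a, blk a = blk v → b a = 0) :
    mkB v b ∈ mkAdm blk l (insert v S) := by
  have hbv := hb v hv
  refine ⟨?_, ?_, ?_⟩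
  · ext a c
    simp only [mkB, Matrix.transpose_apply, Matrix.of_apply, Matrix.neg_apply]
    by_cases ha : a = v <;> by_cases hc : c = v <;> simp [ha, hc, hbv]
  · intro a c hac hl
    simp only [mkB, Matrix.of_apply]
    split_ifs with h1 h2
    · subst h1; exact hbi (hac ▸ hl) a hac
    · subst h2; rw [hbi hl c hac.symm, neg_zero]
    · rfl
  · intro a c ha
    rw [Finset.mem_insert, not_or] at ha
    simp [mkB, ha.1, hb a ha.2]

theorem mkAdm_mono {S T : Finset (Fin n)} (h : S ⊆ T) : mkAdm blk l S ≤ mkAdm blk l T :=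
  fun _ hM => ⟨hM.1, hM.2.1, fun i j hi => hM.2.2 i j fun h' => hi (h h')⟩

theorem mk_step {S : Finset (Fin n)} {v : Fin n} (hv : v ∉ S) {M : Matrix (Fin n) (Fin n) ℝ}
    (hM : M ∈ mkAdm blk l S) {b : Fin n → ℝ} (hb : ∀ a, a ∉ S → b a = 0)
    (hbi : (blk v : ℕ) < l → ∀ a, blk a = blk v → b a = 0)
    (hOm : mkOm blk l (Matrix.diagonal fun i => α (blk i)) S M = ⊤)
    (hQ : mkQ blk l α S (blk v) b M = ⊤) :
    ∃ M' ∈ mkAdm blk l (insert v S),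
      mkOm blk l (Matrix.diagonal fun i => α (blk i)) (insert v S) M' = ⊤ := by
  obtain ⟨c, hc⟩ := mk_span_open (Matrix.stdBasis ℝ (Fin n) (Fin n))
    (fun k s => mkFam blk l α S v M b k s) 0 (by
      rintro k ⟨i, j⟩
      have := (mkFam_cont (l := l) (α := α) (blk := blk) S v M b k).matrix_elem i j
      simpa [Matrix.stdBasis] using this) (mkFam_top hv hM hb hOm hQ)
  have h2 : ∀ᶠ s in nhdsWithin (0 : ℝ) {0}ᶜ, s ≠ 0 := self_mem_nhdsWithin
  obtain ⟨s, hs, hs0⟩ := ((hc.filter_mono nhdsWithin_le_nhds).and h2).exists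
  refine ⟨M + s • mkB v b, add_mem (mkAdm_mono (Finset.subset_insert _ _) hM)
    (Submodule.smul_mem _ _ (mkB_adm hv hb hbi)), ?_⟩
  rw [eq_top_iff, ← hs]
  apply Submodule.span_le.2
  rintro _ ⟨a, rfl⟩
  exact mkFam_mem hv hM hb _ s hs0

/-- combination with genericity -/
theorem mk_step' {S : Finset (Fin n)} {v : Fin n} (hv : v ∉ S) 
    (hP : ∃ M ∈ mkAdm blk l S, mkOm blk l (Matrix.diagonal fun i => α (blk i)) S M = ⊤)
    {b : Fin n → ℝ} (hb : ∀ a, a ∉ S → b a = 0)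
    (hbi : (blk v : ℕ) < l → ∀ a, blk a = blk v → b a = 0)
    (hQ : ∃ M ∈ mkAdm blk l S, mkQ blk l α S (blk v) b M = ⊤) :
    ∃ M' ∈ mkAdm blk l (insert v S),
      mkOm blk l (Matrix.diagonal fun i => α (blk i)) (insert v S) M' = ⊤ := by
  obtain ⟨M1, h1, h1'⟩ := hP
  obtain ⟨M2, h2, h2'⟩ := hQ
  have e1 := mkOm_line blk l (Matrix.diagonal fun i => α (blk i)) S M2 (M1 - M2)
    (by rwa [add_sub_cancel])
  have e2 := mkQ_open S (blk v) b M2 h2'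
  have hcont : Filter.Tendsto (fun s : ℝ => M2 + s • (M1 - M2)) (nhds 0) (nhds M2) := by
    have : Continuous fun s : ℝ => M2 + s • (M1 - M2) := by fun_prop
    have := this.tendsto 0
    simpa using this
  have e3 := (hcont.eventually e2).filter_mono (nhdsWithin_le_nhds (s := {0}ᶜ))
  obtain ⟨s, hs1, hs2⟩ := (e1.and e3).exists
  exact mk_step hv (add_mem h2 (Submodule.smul_mem _ _ (sub_mem h1 h2))) hb hbi hs1 hs2

end mkStep3


section mkMatch

theorem mk_rational {ι : Type*} [DecidableEq ι] (X : Finset ι) (D q e : ι → ℝ) (L : Set ℝ)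
    (hL : L.Infinite) (hden : ∀ z ∈ L, ∀ y ∈ X, z * D y + q y ≠ 0)
    (hsum : ∀ z ∈ L, ∑ y ∈ X, e y / (z * D y + q y) = 0)
    (huniq : ∀ x ∈ X, ∀ y ∈ X, D x = 0 → D y = 0 → x = y)
    (hprop : ∀ x ∈ X, ∀ y ∈ X, x ≠ y → D x ≠ 0 → q y * D x ≠ q x * D y) :
    ∀ x ∈ X, e x = 0 := by
  let P : Polynomial ℝ := ∑ y ∈ X, Polynomial.C (e y) *
    ∏ w ∈ X.erase y, (Polynomial.X * Polynomial.C (D w) + Polynomial.C (q w))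
  have hPe : ∀ z, P.eval z = ∑ y ∈ X, e y * ∏ w ∈ X.erase y, (z * D w + q w) := by
    intro z
    simp [P, Polynomial.eval_finsetSum, Polynomial.eval_prod, mul_comm z]
  have hP0 : P = 0 := by
    apply Polynomial.eq_zero_of_infinite_isRoot
    refine hL.mono fun z hz => ?_
    show P.eval z = 0
    rw [hPe]
    have h1 := congrArg (fun w => w * ∏ y ∈ X, (z * D y + q y)) (hsum z hz)
    simp only [zero_mul, Finset.sum_mul] at h1
    rw [← h1]
    refine Finset.sum_congr rfl fun y hy => ?_
    rw [← Finset.mul_prod_erase X _ hy]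
    field_simp [hden z hz y hy]
  have h1 : ∀ x ∈ X, D x ≠ 0 → e x = 0 := by
    intro x hx hD
    have h2 := hPe (-(q x) / D x)
    rw [hP0, Polynomial.eval_zero, Finset.sum_eq_single x] at h2
    · rcases mul_eq_zero.1 h2.symm with h | h
      · exact h
      · obtain ⟨w, hw, hw0⟩ := Finset.prod_eq_zero_iff.1 h
        rw [Finset.mem_erase] at hw
        exfalso
        apply hprop x hx w hw.2 (Ne.symm hw.1) hD
        field_simp at hw0
        linarith
    · intro y hy hyx
      rw [Finset.prod_eq_zero (i := x), mul_zero]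
      · exact Finset.mem_erase.2 ⟨Ne.symm hyx, hx⟩
      · field_simp; ring
    · intro h; exact absurd hx h
  intro x hx
  by_cases hD : D x = 0
  · obtain ⟨z, hz⟩ := hL.nonempty
    have h2 := hsum z hz
    rw [Finset.sum_eq_single x] at h2
    · rcases div_eq_zero_iff.1 h2 with h | h
      · exact h
      · exact absurd h (hden z hz x hx)
    · intro y hy hyx
      rw [h1 y hy, zero_div]
      intro h
      exact hyx (huniq y hy x hx h hD)
    · intro h; exact absurd hx h
  · exact h1 x hx hD

variable {n r : ℕ} {blk : Fin n → Fin r} {l : ℕ} {α : Fin r → ℝ}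

/-- the matrix of a weighted involution -/
def mkMM (σ : Fin n → Fin n) (m : Fin n → ℝ) : Matrix (Fin n) (Fin n) ℝ :=
  Matrix.of fun x y => if y = σ x then m x else 0

theorem mkMM_mulVec (σ : Fin n → Fin n) (m : Fin n → ℝ) (w : Fin n → ℝ) (x : Fin n) :
    (mkMM σ m *ᵥ w) x = m x * w (σ x) := by
  simp [mkMM, Matrix.mulVec, dotProduct]

/-- explicit solution -/
theorem mkMM_solve (σ : Fin n → Fin n) (hσ : ∀ x, σ (σ x) = x) (m : Fin n → ℝ)
    (hm : ∀ x, m (σ x) = - m x) (g : Fin n → ℝ)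
    (hd : ∀ x, g x * g (σ x) + m x ^ 2 ≠ 0) (b : Fin n → ℝ) :
    (Matrix.diagonal g - mkMM σ m) *ᵥ
      (fun x => (g (σ x) * b x + m x * b (σ x)) / (g x * g (σ x) + m x ^ 2)) = b := by
  funext x
  rw [Matrix.sub_mulVec, Pi.sub_apply, mkMM_mulVec, Matrix.mulVec_diagonal]
  simp only [hσ, hm]
  have h1 := hd x
  have h2 : g (σ x) * g x + (- m x) ^ 2 = g x * g (σ x) + m x ^ 2 := by ring
  rw [h2]
  field_simp
  ring

theorem mkMM_V (S : Finset (Fin n)) (i : Fin r) (σ : Fin n → Fin n) (hσ : ∀ x, σ (σ x) = x)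
    (m : Fin n → ℝ) (hm : ∀ x, m (σ x) = - m x) (t : ℝ) (g : Fin n → ℝ)
    (hg : g = fun a => if a ∈ S then t * (α i - α (blk a)) else 1)
    (hd : ∀ x, g x * g (σ x) + m x ^ 2 ≠ 0) (b : Fin n → ℝ) :
    ∃ c : ℝ, c ≠ 0 ∧ mkV blk α S i b t (mkMM σ m) =
      c • fun x => (g (σ x) * b x) / (g x * g (σ x) + m x ^ 2) := by
  have hG : mkG blk α S i (mkMM σ m) t = Matrix.diagonal g - mkMM σ m := by rw [mkG, hg]
  have hGt : (mkG blk α S i (mkMM σ m) t)ᵀ = Matrix.diagonal g - mkMM σ (fun x => - m x) := by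
    rw [hG, Matrix.transpose_sub, Matrix.diagonal_transpose]
    congr 1
    ext x y
    simp only [mkMM, Matrix.transpose_apply, Matrix.of_apply]
    by_cases h : x = σ y
    · subst h; simp [hσ, hm]
    · have : y ≠ σ x := by rintro rfl; exact h (hσ x).symm
      simp [h, this]
  have s1 := mkMM_solve σ hσ m hm g hd
  have s2 := mkMM_solve σ hσ (fun x => - m x) (fun x => by simp [hm]) g
    (by intro x; simpa using hd x)
  rw [← hG] at s1
  rw [← hGt] at s2
  set G := mkG blk α S i (mkMM σ m) t with hGd
  have hu : IsUnit G := Matrix.mulVec_surjective_iff_isUnit.1 fun b => ⟨_, s1 b⟩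
  have hdet : G.det ≠ 0 := ((Matrix.isUnit_iff_isUnit_det _).1 hu).ne_zero
  have a1 := mk_adj hdet (by rw [Matrix.mulVec_smul, s1 b] : G *ᵥ (G.det • _) = G.det • b)
  have a2 := mk_adj (G := Gᵀ) (by rwa [Matrix.det_transpose])
    (by rw [Matrix.mulVec_smul, s2 b] : Gᵀ *ᵥ (Gᵀ.det • _) = Gᵀ.det • b)
  refine ⟨G.det * G.det * 2, by simp [hdet], ?_⟩
  rw [mkV, ← hGd, ← a1, ← a2, Matrix.det_transpose]
  funext x
  simp only [Pi.smul_apply, Pi.add_apply, smul_eq_mul]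
  have h1 := hd x
  have h2 : g x * g (σ x) + (- m x) ^ 2 = g x * g (σ x) + m x ^ 2 := by ring
  rw [h2]
  field_simp
  ring

theorem mk_qmatch (hα : Function.Injective α) (S : Finset (Fin n)) (i : Fin r) (σ : Fin n → Fin n)
    (hσ : ∀ x, σ (σ x) = x) (hσS : ∀ x, x ∉ S → σ x = x)
    (h0 : ∀ x, σ x ≠ x → blk (σ x) = blk x → l ≤ (blk x : ℕ))
    (c1 : l ≤ (i : ℕ) → ∀ u w, blk u = i → blk (σ u) ≠ i → blk w = i → blk (σ w) ≠ i → u = w)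
    (c2 : ∀ u ∈ S, ∀ w ∈ S, σ u = u → σ w = w → blk u ≠ i → blk w ≠ i → u = w)
    (c3 : (∀ u ∈ S, σ u = u → blk u ≠ i) ∨
      ((i : ℕ) < l ∧ ∀ u ∈ S, blk u ≠ i → blk (σ u) = i)) :
    ∃ b : Fin n → ℝ, (∀ a, a ∉ S → b a = 0) ∧ ((i : ℕ) < l → ∀ a, blk a = i → b a = 0) ∧
      ∃ M ∈ mkAdm blk l S, mkQ blk l α S i b M = ⊤ := by
  classical
  let X : Finset (Fin n) := S.filter fun x =>
    blk (σ x) ≠ i ∧ (blk x ≠ i → x ≤ σ x) ∧ ((i : ℕ) < l → blk x ≠ i)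
  have hX : ∀ x, x ∈ X ↔ x ∈ S ∧ blk (σ x) ≠ i ∧ (blk x ≠ i → x ≤ σ x) ∧ ((i : ℕ) < l → blk x ≠ i) := by
    intro x; simp [X]
  have hσS' : ∀ x, x ∈ S → σ x ∈ S := by
    intro x hx
    by_contra h
    have := hσS _ h
    rw [hσ] at this
    exact h (this ▸ hx)
  let d : Fin n → ℝ := fun x => α i - α (blk x)
  have hd0 : ∀ x, d x = 0 ↔ blk x = i := by
    intro x
    simp only [d, sub_eq_zero]
    constructor
    · intro h; exact (hα h).symm
    · rintro rfl; rfl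
  let D : Fin n → ℝ := fun x => d x * d (σ x)
  have hDσ : ∀ x, D (σ x) = D x := by intro x; simp only [D, hσ]; ring
  let q : Fin n → ℝ := fun x => if σ x = x then 0 else if D x = 0 then 1 else
    |D x| * (((min x (σ x) : Fin n) : ℕ) + 1 : ℝ)
  have hqσ : ∀ x, q (σ x) = q x := by
    intro x
    simp only [q, hσ, hDσ, min_comm (σ x) x]
    by_cases h : σ x = x
    · rw [if_pos h, if_pos h.symm]
    · rw [if_neg h, if_neg (Ne.symm h)]
  have hq0 : ∀ x, 0 ≤ q x := by
    intro x; simp only [q]; split_ifs <;> positivity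
  have hqpos : ∀ x, σ x ≠ x → 0 < q x := by
    intro x hx
    simp only [q, if_neg hx]
    split_ifs with h
    · norm_num
    · have := abs_pos.2 h
      positivity
  let m : Fin n → ℝ := fun x => (if x < σ x then 1 else -1) * Real.sqrt (q x)
  have hmq : ∀ x, m x ^ 2 = q x := by
    intro x
    simp only [m, mul_pow, Real.sq_sqrt (hq0 x)]
    split_ifs <;> simp
  have hm : ∀ x, m (σ x) = - m x := by
    intro x
    simp only [m, hqσ, hσ]
    rcases lt_trichotomy x (σ x) with h | h | h
    · simp [h, not_lt.2 h.le]
    · have : q x = 0 := by simp [q, h.symm]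
      simp [this]
    · simp [h, not_lt.2 h.le]
  have hm0 : ∀ x, σ x = x → m x = 0 := by
    intro x hx
    have : q x = 0 := by simp [q, hx]
    simp [m, this]
  have hmne : ∀ x, σ x ≠ x → m x ≠ 0 := by
    intro x hx h
    have h1 := hmq x
    rw [h] at h1
    have := hqpos x hx
    rw [← h1] at this
    norm_num at this
  let b : Fin n → ℝ := fun x => if x ∈ X then 1 else 0
  refine ⟨b, ?_, ?_, mkMM σ m, ⟨?_, ?_, ?_⟩, ?_⟩
  · intro a ha
    simp [b, hX, ha]
  · intro hi a ha
    have : a ∉ X := by rw [hX]; rintro ⟨_, _, _, h⟩; exact h hi ha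
    simp [b, this]
  · ext x y
    simp only [mkMM, Matrix.transpose_apply, Matrix.of_apply, Matrix.neg_apply]
    by_cases h : x = σ y
    · subst h; simp [hσ, hm]
    · have : y ≠ σ x := by rintro rfl; exact h (hσ x).symm
      simp [h, this]
  · intro x y hxy hl
    simp only [mkMM, Matrix.of_apply]
    split_ifs with h
    · subst h
      by_cases hx : σ x = x
      · exact hm0 x hx
      · have := h0 x hx hxy.symm
        omega
    · rfl
  · intro x y hx
    simp [mkMM, hm0 x (hσS x hx)]
  -- the span
  set N := mkQ blk l α S i b (mkMM σ m) with hN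
  have gen : ∀ k, mkQGen blk l α S i b k (mkMM σ m) ∈ N := fun k => Submodule.subset_span ⟨k, rfl⟩
  have hMe : ∀ x, mkMM σ m *ᵥ Pi.single (σ x) 1 = m x • Pi.single x (1 : ℝ) := by
    intro x
    funext y
    rw [mkMM_mulVec]
    by_cases h : y = x
    · subst h; simp
    · have : σ y ≠ σ x := fun h' => h (by rw [← hσ y, h', hσ])
      simp [h, this]
  -- vectors in the span of the V
  let W := Submodule.span ℝ (Set.range fun t => mkV blk α S i b t (mkMM σ m))
  have hW1 : ∀ w ∈ W, w ∈ N := by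
    intro w hw
    refine (Submodule.span_le.2 ?_ : W ≤ N) hw
    rintro _ ⟨t, rfl⟩
    exact gen (.inr (.inr (.inl t)))
  have hW2 : ∀ w ∈ W, mkMM σ m *ᵥ w ∈ N := by
    intro w hw
    refine (Submodule.span_le.2 ?_ : W ≤ N.comap (mkMM σ m).mulVecLin) hw
    rintro _ ⟨t, rfl⟩
    exact gen (.inr (.inr (.inr t)))
  have hXW : ∀ x ∈ X, Pi.single x 1 ∈ W := by
    rcases c3 with c3 | ⟨c3, c3'⟩
    swap
    · intro x hx
      exfalso
      rw [hX] at hx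
      exact hx.2.1 (c3' x hx.1 (hx.2.2.2 c3))
    -- good parameters
    let T : Set ℝ := {z | 0 < z ∧ ∀ x ∈ S, z * D x + q x ≠ 0}
    have hDq : ∀ x ∈ S, D x = 0 → q x ≠ 0 := by
      intro x hx hD
      have : σ x ≠ x := by
        intro h
        have hh : d x = 0 := by
          simp only [D, h] at hD
          simpa using hD
        exact c3 x hx h ((hd0 x).1 hh)
      exact (hqpos x this).ne'
    have hTinf : T.Infinite := by
      have h1 : (⋃ x ∈ S, {z : ℝ | z * D x + q x = 0}).Finite := by
        refine S.finite_toSet.biUnion fun x hx => ?_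
        by_cases hD : D x = 0
        · have := hDq x hx hD
          simp [hD, this]
        · refine (Set.finite_singleton (- q x / D x)).subset ?_
          intro z hz
          simp only [Set.mem_ofPred_eq] at hz
          simp only [Set.mem_singleton_iff]
          field_simp
          linarith
      refine ((Set.Ioi_infinite (0 : ℝ)).sdiff h1).mono ?_
      rintro z ⟨hz, hz'⟩
      refine ⟨hz, fun x hx h => hz' ?_⟩
      simp only [Set.mem_iUnion]
      exact ⟨x, hx, h⟩
    have hV : ∀ z ∈ T, (fun x => if x ∈ X then d (σ x) / (z * D x + q x) else 0) ∈ W := by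
      intro z hz
      set t := Real.sqrt z with ht
      have htp : 0 < t := Real.sqrt_pos.2 hz.1
      have htz : t * t = z := Real.mul_self_sqrt hz.1.le
      obtain ⟨g, hg⟩ : ∃ g : Fin n → ℝ, g = fun a => if a ∈ S then t * (α i - α (blk a)) else 1 :=
        ⟨_, rfl⟩
      have hgS : ∀ x ∈ S, g x = t * d x := by intro x hx; simp [hg, hx, d]
      have hgg : ∀ x ∈ S, g x * g (σ x) + m x ^ 2 = z * D x + q x := by
        intro x hx
        rw [hgS x hx, hgS _ (hσS' x hx), hmq, ← htz]
        simp only [D]; ring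
      have hdd : ∀ x, g x * g (σ x) + m x ^ 2 ≠ 0 := by
        intro x
        by_cases hx : x ∈ S
        · rw [hgg x hx]; exact hz.2 x hx
        · rw [hσS x hx, hm0 x (hσS x hx)]
          simp [hg, hx]
      obtain ⟨c, hc, hcV⟩ := mkMM_V (blk := blk) (α := α) S i σ hσ m hm t g hg hdd b
      have h1 : mkV blk α S i b t (mkMM σ m) ∈ W := Submodule.subset_span ⟨t, rfl⟩
      rw [hcV] at h1
      have h2 := Submodule.smul_mem W (c⁻¹ * t⁻¹) h1
      convert h2 using 1
      funext x
      simp only [Pi.smul_apply, smul_eq_mul, b]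
      by_cases hx : x ∈ X
      · have hxS := ((hX x).1 hx).1
        rw [if_pos hx, if_pos hx, hgg x hxS, hgS _ (hσS' x hxS)]
        have := hz.2 x hxS
        field_simp
      · simp [hx]
    intro x hx
    by_contra hcon
    obtain ⟨φ, hφ1, hφ2⟩ := Submodule.exists_le_ker_of_notMem hcon
    apply hφ1
    have hφ : ∀ w : Fin n → ℝ, φ w = ∑ y, w y * φ (Pi.single y 1) := by
      intro w
      conv_lhs => rw [← Finset.univ_sum_single w, map_sum]
      refine Finset.sum_congr rfl fun y _ => ?_
      have : Pi.single y (w y) = w y • (Pi.single y 1 : Fin n → ℝ) := by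
        rw [← Pi.single_smul]; simp
      rw [this, map_smul, smul_eq_mul]
    have key := mk_rational X D q (fun y => d (σ y) * φ (Pi.single y 1)) T hTinf
      (fun z hz y hy => hz.2 y ((hX y).1 hy).1)
      (by
        intro z hz
        have h1 : φ _ = 0 := hφ2 (hV z hz)
        rw [hφ] at h1
        rw [← h1, ← Finset.sum_filter_add_sum_filter_not Finset.univ (fun y => y ∈ X)]
        rw [Finset.sum_eq_zero (s := Finset.univ.filter fun y => y ∉ X), add_zero]
        · rw [Finset.filter_univ_mem]
          refine Finset.sum_congr rfl fun y hy => ?_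
          rw [if_pos hy]; ring
        · intro y hy
          rw [if_neg (Finset.mem_filter.1 hy).2, zero_mul])
      (by
        intro x hx y hy hDx hDy
        rw [hX] at hx hy
        have hbx : ∀ x, blk (σ x) ≠ i → D x = 0 → blk x = i := by
          intro x h1 h2
          rcases mul_eq_zero.1 h2 with h | h
          · exact (hd0 x).1 h
          · exact absurd ((hd0 _).1 h) h1
        have h1 := hbx x hx.2.1 hDx
        have h2 := hbx y hy.2.1 hDy
        refine c1 ?_ x y h1 hx.2.1 h2 hy.2.1
        by_contra h
        exact hx.2.2.2 (not_le.1 h) h1)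
      (by
        intro x hx y hy hxy hDx
        rw [hX] at hx hy
        have hbx : blk x ≠ i := by
          intro h
          exact hDx (by simp [D, (hd0 x).2 h])
        by_cases hDy : D y = 0
        · rw [hDy, mul_zero]
          exact mul_ne_zero (hDq y hy.1 hDy) hDx
        have hby : blk y ≠ i := by
          intro h
          exact hDy (by simp [D, (hd0 y).2 h])
        by_cases hfx : σ x = x
        · have hfy : σ y ≠ y := fun h => hxy (c2 x hx.1 y hy.1 hfx h hbx hby)
          have : q x = 0 := by simp [q, hfx]
          rw [this, zero_mul]
          exact mul_ne_zero (hqpos y hfy).ne' hDx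
        by_cases hfy : σ y = y
        · have : q y = 0 := by simp [q, hfy]
          rw [this, zero_mul]
          exact (mul_ne_zero (hqpos x hfx).ne' hDy).symm
        intro heq
        have h1 := congrArg abs heq
        rw [abs_mul (q y) (D x), abs_mul (q x) (D y), abs_of_nonneg (hq0 x), abs_of_nonneg (hq0 y)] at h1
        simp only [q, if_neg hfx, if_neg hfy, if_neg hDx, if_neg hDy,
          min_eq_left (hx.2.2.1 hbx), min_eq_left (hy.2.2.1 hby)] at h1
        have hp1 := abs_pos.2 hDx
        have hp2 := abs_pos.2 hDy
        have h2 : ((y : ℕ) : ℝ) = ((x : ℕ) : ℝ) := by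
          have h3 : (|D x| * |D y|) * (((y : ℕ) : ℝ) - ((x : ℕ) : ℝ)) = 0 := by linarith
          rcases mul_eq_zero.1 h3 with h | h
          · exact absurd h (mul_pos hp1 hp2).ne'
          · linarith
        exact hxy (Fin.ext (by exact_mod_cast h2.symm))) x hx
    have hxx := (hX x).1 hx
    rcases mul_eq_zero.1 key with h | h
    · exact absurd ((hd0 _).1 h) hxx.2.1
    · exact h
  have hsolve : ∀ x, σ x ≠ x → mkMM σ m *ᵥ Pi.single (σ x) 1 ∈ N → Pi.single x (1 : ℝ) ∈ N := by
    intro x hx h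
    rw [hMe] at h
    have h2 := Submodule.smul_mem N (m x)⁻¹ h
    rwa [smul_smul, inv_mul_cancel₀ (hmne x hx), one_smul] at h2
  have hall : ∀ x, Pi.single x (1 : ℝ) ∈ N := by
    intro x
    by_cases h1 : x ∉ S ∨ blk x = i
    · exact gen (.inl ⟨x, h1⟩)
    push Not at h1
    by_cases h2 : blk (σ x) = i
    · have hx : σ x ≠ x := fun h => h1.2 (h ▸ h2)
      by_cases hi : (i : ℕ) < l
      · exact hsolve x hx (gen (.inr (.inl ⟨σ x, h2, hi⟩)))
      · refine hsolve x hx (hW2 _ (hXW _ ?_))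
        rw [hX, hσ]
        exact ⟨hσS' x h1.1, h1.2, fun h => absurd h2 h, fun h => absurd h hi⟩
    · by_cases hle : x ≤ σ x
      · refine hW1 _ (hXW _ ?_)
        rw [hX]
        exact ⟨h1.1, h2, fun _ => hle, fun _ => h1.2⟩
      · have hx : σ x ≠ x := fun h => hle h.ge
        refine hsolve x hx (hW2 _ (hXW _ ?_))
        rw [hX, hσ]
        exact ⟨hσS' x h1.1, h1.2, fun _ => (not_le.1 hle).le, fun _ => h2⟩
  rw [eq_top_iff]
  intro w _
  rw [← Finset.univ_sum_single w]
  refine sum_mem fun y _ => ?_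
  have : Pi.single y (w y) = w y • (Pi.single y 1 : Fin n → ℝ) := by
    rw [← Pi.single_smul]; simp
  rw [this]
  exact Submodule.smul_mem _ _ (hall y)

end mkMatch


section mkInd
variable {n r : ℕ} {blk : Fin n → Fin r} {l : ℕ} {α : Fin r → ℝ}

theorem mk_transport (T : Finset (Fin n)) {N : ℕ} (hN : T.card = N) (τ : Fin N → Fin N)
    (hτ : ∀ k, τ (τ k) = k) :
    ∃ σ : Fin n → Fin n, (∀ x, σ (σ x) = x) ∧ (∀ x, x ∉ T → σ x = x) ∧
      ∀ k, σ (T.orderEmbOfFin hN k) = T.orderEmbOfFin hN (τ k) := by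
  classical
  let e := T.orderEmbOfFin hN
  let σ : Fin n → Fin n := fun x => if h : ∃ k, e k = x then e (τ h.choose) else x
  have h1 : ∀ k, σ (e k) = e (τ k) := by
    intro k
    have h : ∃ k', e k' = e k := ⟨k, rfl⟩
    have h2 : h.choose = k := e.injective h.choose_spec
    simp only [σ, dif_pos h, h2]
  have h2 : ∀ x, (¬ ∃ k, e k = x) → σ x = x := by
    intro x hx
    simp only [σ, dif_neg hx]
  refine ⟨σ, ?_, ?_, h1⟩
  · intro x
    by_cases hx : ∃ k, e k = x
    · obtain ⟨k, rfl⟩ := hx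
      rw [h1, h1, hτ]
    · rw [h2 x hx, h2 x hx]
  · intro x hx
    apply h2
    rintro ⟨k, rfl⟩
    exact hx (Finset.orderEmbOfFin_mem T hN k)

theorem mk_index (T : Finset (Fin n)) {N : ℕ} (hN : T.card = N) {x : Fin n} (hx : x ∈ T) :
    ∃ k, T.orderEmbOfFin hN k = x := by
  have : x ∈ Set.range (T.orderEmbOfFin hN) := by
    rw [Finset.range_orderEmbOfFin]; exact hx
  exact this

theorem mk_pm (hmono : Monotone blk) (T : Finset (Fin n)) (h : ℕ) (hT : T.card = 2 * h)
    (hb : ∀ j : Fin r, (j : ℕ) < l → (T.filter fun x => blk x = j).card ≤ h) :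
    ∃ σ : Fin n → Fin n, (∀ x, σ (σ x) = x) ∧ (∀ x, x ∉ T → σ x = x) ∧ (∀ x ∈ T, σ x ≠ x) ∧
      (∀ x ∈ T, blk (σ x) = blk x → l ≤ (blk x : ℕ)) := by
  let τ : Fin (2 * h) → Fin (2 * h) := fun k =>
    if hk : (k : ℕ) < h then ⟨k + h, by omega⟩ else ⟨k - h, by omega⟩
  have hτ : ∀ k, τ (τ k) = k := by
    intro k
    apply Fin.ext
    by_cases hk : (k : ℕ) < h
    · have : τ k = ⟨k + h, by omega⟩ := by simp [τ, hk]
      rw [this]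
      simp [τ]
    · have : τ k = ⟨k - h, by omega⟩ := by simp [τ, hk]
      rw [this]
      have := k.2
      have h3 : (k : ℕ) - h < h := by omega
      simp only [τ, h3, dif_pos]
      omega
  have hval : ∀ k, ((τ k : ℕ) = k + h ∧ (k : ℕ) < h) ∨ ((τ k : ℕ) + h = k) := by
    intro k
    by_cases hk : (k : ℕ) < h
    · left; simp [τ, hk]
    · right
      simp only [τ, hk, dif_neg, not_false_eq_true]
      omega
  obtain ⟨σ, s1, s2, s3⟩ := mk_transport T hT τ hτ
  refine ⟨σ, s1, s2, ?_, ?_⟩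
  · intro x hx hfix
    obtain ⟨k, rfl⟩ := mk_index T hT hx
    rw [s3] at hfix
    have := (T.orderEmbOfFin hT).injective hfix
    have h1 := congrArg Fin.val this
    have := k.2
    rcases hval k with h2 | h2 <;> omega
  · -- long intervals in one block
    have key : ∀ k k' : Fin (2 * h), (k' : ℕ) = k + h → 
        blk (T.orderEmbOfFin hT k') = blk (T.orderEmbOfFin hT k) →
        l ≤ (blk (T.orderEmbOfFin hT k) : ℕ) := by
      intro k k' hkk hblk
      by_contra hlt
      have h1 := hb _ (not_le.1 hlt)
      have h2 : (Finset.Icc k k').card = h + 1 := by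
        rw [Fin.card_Icc]; omega
      have h3 : ((Finset.Icc k k').map (T.orderEmbOfFin hT).toEmbedding).card ≤
          (T.filter fun x => blk x = blk (T.orderEmbOfFin hT k)).card := by
        apply Finset.card_le_card
        intro x hx
        rw [Finset.mem_map] at hx
        obtain ⟨e, he, rfl⟩ := hx
        rw [Finset.mem_Icc] at he
        rw [Finset.mem_filter]
        refine ⟨Finset.orderEmbOfFin_mem T hT e, ?_⟩
        apply le_antisymm
        · rw [← hblk]
          exact hmono ((T.orderEmbOfFin hT).monotone he.2)
        · exact hmono ((T.orderEmbOfFin hT).monotone he.1)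
      rw [Finset.card_map, h2] at h3
      omega
    intro x hx hblk
    obtain ⟨k, rfl⟩ := mk_index T hT hx
    rw [s3] at hblk
    rcases hval k with h2 | h2
    · exact key k (τ k) h2.1 hblk
    · rw [← hblk]
      exact key (τ k) k h2.symm hblk.symm

variable (blk l α) in
def mkP (S : Finset (Fin n)) : Prop :=
  ∃ M ∈ mkAdm blk l S, mkOm blk l (Matrix.diagonal fun i => α (blk i)) S M = ⊤

/-- induction step from a matching -/
theorem mk_ind_step (hα : Function.Injective α) {S : Finset (Fin n)} {v : Fin n} (hv : v ∈ S)
    (hP : mkP blk l α (S.erase v)) (σ : Fin n → Fin n)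
    (hσ : ∀ x, σ (σ x) = x) (hσS : ∀ x, x ∉ S.erase v → σ x = x)
    (h0 : ∀ x, σ x ≠ x → blk (σ x) = blk x → l ≤ (blk x : ℕ))
    (c1 : l ≤ (blk v : ℕ) → ∀ u w, blk u = blk v → blk (σ u) ≠ blk v → blk w = blk v →
      blk (σ w) ≠ blk v → u = w)
    (c2 : ∀ u ∈ S.erase v, ∀ w ∈ S.erase v, σ u = u → σ w = w → blk u ≠ blk v → blk w ≠ blk v →
      u = w)
    (c3 : (∀ u ∈ S.erase v, σ u = u → blk u ≠ blk v) ∨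
      ((blk v : ℕ) < l ∧ ∀ u ∈ S.erase v, blk u ≠ blk v → blk (σ u) = blk v)) :
    mkP blk l α S := by
  obtain ⟨b, hb, hbi, hQ⟩ := mk_qmatch hα (S.erase v) (blk v) σ hσ hσS h0 c1 c2 c3
  have := mk_step' (Finset.notMem_erase v S) hP hb hbi hQ
  rw [Finset.insert_erase hv] at this
  exact this

theorem mk_case_k (hmono : Monotone blk) (hα : Function.Injective α) {S : Finset (Fin n)}
    (ih : ∀ v ∈ S, mkP blk l α (S.erase v)) (hS : ∀ x ∈ S, l ≤ (blk x : ℕ))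
    (hne : ∃ x ∈ S, ∃ y ∈ S, blk x ≠ blk y) : mkP blk l α S := by
  have hSne : S.Nonempty := by obtain ⟨x, hx, _⟩ := hne; exact ⟨x, hx⟩
  obtain ⟨v, hv, hvmin⟩ : ∃ v ∈ S, ∀ x ∈ S, v ≤ x :=
    ⟨S.min' hSne, S.min'_mem hSne, fun x hx => S.min'_le x hx⟩
  obtain ⟨y, hy, hyv⟩ : ∃ y ∈ S, blk y ≠ blk v := by
    obtain ⟨x, hx, y, hy, hxy⟩ := hne
    by_cases h : blk x = blk v
    · exact ⟨y, hy, fun h' => hxy (h.trans h'.symm)⟩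
    · exact ⟨x, hx, h⟩
  set T := S.erase v with hTd
  have hTS : ∀ x ∈ T, x ∈ S := fun x hx => Finset.mem_of_mem_erase hx
  have hyT : y ∈ T := Finset.mem_erase.2 ⟨fun h => hyv (h ▸ rfl), hy⟩
  obtain ⟨N, hN⟩ : ∃ N, T.card = N := ⟨_, rfl⟩
  let τ : Fin N → Fin N := fun k =>
    if (k : ℕ) % 2 = 0 then (if hk : (k : ℕ) + 1 < N then ⟨k + 1, hk⟩ else k)
    else ⟨k - 1, by omega⟩
  have hval : ∀ k : Fin N, ((k : ℕ) % 2 = 0 ∧ (τ k : ℕ) = k + 1) ∨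
      ((k : ℕ) % 2 = 0 ∧ (k : ℕ) + 1 = N ∧ (τ k : ℕ) = k) ∨
      ((k : ℕ) % 2 = 1 ∧ (τ k : ℕ) + 1 = k) := by
    intro k
    by_cases h1 : (k : ℕ) % 2 = 0
    · by_cases hk : (k : ℕ) + 1 < N
      · left; simp [τ, h1, hk]
      · right; left
        have := k.2
        refine ⟨h1, by omega, by simp [τ, h1, hk]⟩
    · right; right
      refine ⟨by omega, ?_⟩
      simp only [τ, if_neg h1]
      omega
  have hτ : ∀ k, τ (τ k) = k := by
    intro k
    apply Fin.ext
    have := k.2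
    rcases hval k with h | h | h <;> rcases hval (τ k) with h' | h' | h' <;> omega
  obtain ⟨σ, s1, s2, s3⟩ := mk_transport T hN τ hτ
  set e := T.orderEmbOfFin hN with he
  have heS : ∀ k, e k ∈ S := fun k => hTS _ (Finset.orderEmbOfFin_mem T hN k)
  have hblkv : ∀ k, blk v ≤ blk (e k) := fun k => hmono (hvmin _ (heS k))
  have hidx : ∀ x, σ x ≠ x → ∃ k, e k = x := by
    intro x hx
    apply mk_index T hN
    by_contra h
    exact hx (s2 x h)
  have hfixed : ∀ u ∈ T, σ u = u → ∃ k : Fin N, e k = u ∧ (k : ℕ) + 1 = N := by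
    intro u hu hfix
    obtain ⟨k, rfl⟩ := mk_index T hN hu
    refine ⟨k, rfl, ?_⟩
    rw [s3] at hfix
    have h1 := congrArg Fin.val (e.injective hfix)
    rcases hval k with h | h | h <;> omega
  refine mk_ind_step hα hv (ih v hv) σ s1 s2 ?_ ?_ ?_ ?_
  · intro x hx _
    obtain ⟨k, rfl⟩ := hidx x hx
    exact hS _ (heS k)
  · intro _
    have key : ∀ u, blk u = blk v → blk (σ u) ≠ blk v → ∃ k : Fin N, e k = u ∧ (τ k : ℕ) = k + 1 ∧
        blk (e (τ k)) ≠ blk v := by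
      intro u hu hu'
      have hne : σ u ≠ u := fun h => hu' (by rw [h]; exact hu)
      obtain ⟨k, rfl⟩ := hidx u hne
      rw [s3] at hu'
      refine ⟨k, rfl, ?_, hu'⟩
      have h1 : ¬ (τ k ≤ k) := by
        intro h1
        have h2 := hmono (e.monotone h1)
        rw [hu] at h2
        exact hu' (le_antisymm h2 (hblkv _))
      have h2 : (k : ℕ) < τ k := not_le.1 h1
      rcases hval k with h | h | h <;> omega
    have key2 : ∀ k k' : Fin N, blk (e k') = blk v → (τ k : ℕ) = k + 1 → blk (e (τ k)) ≠ blk v →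
        ¬ (k < k') := by
      intro k k' h1 h2 h3 h4
      have h5 : τ k ≤ k' := by
        have : (k : ℕ) < k' := h4
        show (τ k : ℕ) ≤ k'
        omega
      have h6 := hmono (e.monotone h5)
      rw [h1] at h6
      exact h3 (le_antisymm h6 (hblkv _))
    intro u w hu hu' hw hw'
    obtain ⟨k, rfl, h2, h3⟩ := key u hu hu'
    obtain ⟨k', rfl, h2', h3'⟩ := key w hw hw'
    rcases lt_trichotomy k k' with h | h | h
    · exact absurd h (key2 k k' hw h2 h3)
    · rw [h]
    · exact absurd h (key2 k' k hu h2' h3')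
  · intro u hu w hw hfu hfw _ _
    obtain ⟨k, rfl, hk⟩ := hfixed u hu hfu
    obtain ⟨k', rfl, hk'⟩ := hfixed w hw hfw
    have : k = k' := Fin.ext (by omega)
    rw [this]
  · left
    intro u hu hfu hblk
    obtain ⟨k, rfl, hk⟩ := hfixed u hu hfu
    obtain ⟨k', rfl⟩ := mk_index T hN hyT
    have h1 : k' ≤ k := by
      have := k'.2
      show (k' : ℕ) ≤ k
      omega
    have h2 := hmono (e.monotone h1)
    rw [hblk] at h2
    exact hyv (le_antisymm h2 (hblkv _))

theorem mk_case_a (hmono : Monotone blk) (hα : Function.Injective α) {S : Finset (Fin n)}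
    (ih : ∀ v ∈ S, mkP blk l α (S.erase v)) (i : Fin r) (hi : (i : ℕ) < l)
    (hbig : S.card < 2 * (S.filter fun x => blk x = i).card) : mkP blk l α S := by
  classical
  have hsplit := Finset.card_filter_add_card_filter_not (s := S) (fun x => blk x = i)
  set R := S.filter fun x => ¬ blk x = i with hR
  obtain ⟨v, hv⟩ : (S.filter fun x => blk x = i).Nonempty := by
    rw [← Finset.card_pos]; omega
  have hvS : v ∈ S := (Finset.mem_filter.1 hv).1
  have hvi : blk v = i := (Finset.mem_filter.1 hv).2
  obtain ⟨Z, hZ, hZc⟩ : ∃ Z ⊆ (S.filter fun x => blk x = i).erase v, Z.card = R.card := by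
    apply Finset.exists_subset_card_eq
    rw [Finset.card_erase_of_mem hv]
    omega
  have hZi : ∀ z ∈ Z, z ∈ S ∧ blk z = i ∧ z ≠ v := by
    intro z hz
    have h1 := Finset.mem_erase.1 (hZ hz)
    have h2 := Finset.mem_filter.1 h1.2
    exact ⟨h2.1, h2.2, h1.1⟩
  have hRi : ∀ z, z ∈ R ↔ z ∈ S ∧ blk z ≠ i := by intro z; simp [hR]
  have hdisj : Disjoint Z R := by
    rw [Finset.disjoint_left]
    intro z hz hz'
    exact ((hRi z).1 hz').2 (hZi z hz).2.1
  obtain ⟨σ, s1, s2, s3, s4⟩ := mk_pm (l := l) hmono (Z ∪ R) R.card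
    (by rw [Finset.card_union_of_disjoint hdisj, hZc]; ring) (by
      intro j _
      by_cases hj : j = i
      · subst hj
        rw [← hZc]
        apply Finset.card_le_card
        intro x hx
        rw [Finset.mem_filter, Finset.mem_union] at hx
        rcases hx.1 with h | h
        · exact h
        · exact absurd hx.2 ((hRi x).1 h).2
      · apply Finset.card_le_card
        intro x hx
        rw [Finset.mem_filter, Finset.mem_union] at hx
        rcases hx.1 with h | h
        · exact absurd (hx.2.symm.trans (hZi x h).2.1) hj
        · exact h)
  have s5 : ∀ x, x ∈ Z ∪ R → σ x ∈ Z ∪ R := by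
    intro x hx
    by_contra h
    have := s2 _ h
    rw [s1] at this
    exact h (this ▸ hx)
  have himg : Z.image σ = R := by
    apply Finset.eq_of_subset_of_card_le
    · intro x hx
      obtain ⟨z, hz, rfl⟩ := Finset.mem_image.1 hx
      have h1 := s5 z (Finset.mem_union_left _ hz)
      rcases Finset.mem_union.1 h1 with h | h
      · exfalso
        have := s4 z (Finset.mem_union_left _ hz) ((hZi _ h).2.1.trans (hZi z hz).2.1.symm)
        rw [(hZi z hz).2.1] at this
        omega
      · exact h
    · rw [Finset.card_image_of_injective, hZc]
      intro x y hxy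
      rw [← s1 x, hxy, s1]
  have hRσ : ∀ u ∈ R, blk (σ u) = i := by
    intro u hu
    rw [← himg] at hu
    obtain ⟨z, hz, rfl⟩ := Finset.mem_image.1 hu
    rw [s1]
    exact (hZi z hz).2.1
  have hRσ' : ∀ u ∈ S.erase v, blk u ≠ blk v → blk (σ u) = blk v := by
    intro u hu hne
    rw [hvi] at hne ⊢
    exact hRσ u ((hRi u).2 ⟨Finset.mem_of_mem_erase hu, hne⟩)
  refine mk_ind_step hα hvS (ih v hvS) σ s1 ?_ ?_ ?_ ?_ ?_
  · intro x hx
    apply s2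
    intro h
    apply hx
    rcases Finset.mem_union.1 h with h | h
    · exact Finset.mem_erase.2 ⟨(hZi x h).2.2, (hZi x h).1⟩
    · have := (hRi x).1 h
      refine Finset.mem_erase.2 ⟨?_, this.1⟩
      rintro rfl
      exact this.2 hvi
  · intro x hx hblk
    refine s4 x ?_ hblk
    by_contra h
    exact hx (s2 x h)
  · intro h
    rw [hvi] at h
    omega
  · intro u hu w _ hfu _ hbu _
    have := hRσ' u hu hbu
    rw [hfu] at this
    exact absurd this hbu
  · right
    exact ⟨by rw [hvi]; exact hi, hRσ'⟩

theorem mk_case_b (hmono : Monotone blk) (hα : Function.Injective α) {S : Finset (Fin n)}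
    (ih : ∀ v ∈ S, mkP blk l α (S.erase v)) (v : Fin n) (hv : v ∈ S) (hvl : (blk v : ℕ) < l)
    (hsmall : ∀ i : Fin r, (i : ℕ) < l → 2 * (S.filter fun x => blk x = i).card ≤ S.card) :
    mkP blk l α S := by
  classical
  rcases Nat.even_or_odd' S.card with ⟨h, hc | hc⟩
  · obtain ⟨σ, s1, s2, s3, s4⟩ := mk_pm (l := l) hmono S h hc (by
      intro j hj
      have := hsmall j hj
      omega)
    have hinj : ∀ x y, σ x = σ y → x = y := by
      intro x y hxy
      rw [← s1 x, hxy, s1]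
    let ρ : Fin n → Fin n := fun x => if x = v ∨ x = σ v then x else σ x
    have r1 : ∀ x, x = v ∨ x = σ v → ρ x = x := fun x hx => by simp only [ρ, if_pos hx]
    have r2 : ∀ x, ¬(x = v ∨ x = σ v) → ρ x = σ x := fun x hx => by simp only [ρ, if_neg hx]
    have hfixed : ∀ u ∈ S.erase v, ρ u = u → u = σ v := by
      intro u hu hfu
      by_contra hne
      have huv := (Finset.mem_erase.1 hu).1
      rw [r2 u (by rintro (h | h); exacts [huv h, hne h])] at hfu
      exact s3 u (Finset.mem_of_mem_erase hu) hfu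
    have hmem : ∀ x, ρ x ≠ x → x ∈ S ∧ ρ x = σ x := by
      intro x hx
      have h1 : ¬(x = v ∨ x = σ v) := fun h => hx (r1 x h)
      refine ⟨?_, r2 x h1⟩
      by_contra h
      rw [r2 x h1] at hx
      exact hx (s2 x h)
    refine mk_ind_step hα hv (ih v hv) ρ ?_ ?_ ?_ ?_ ?_ ?_
    · intro x
      by_cases hx : x = v ∨ x = σ v
      · rw [r1 x hx, r1 x hx]
      · rw [r2 x hx, r2 (σ x), s1]
        rintro (h | h)
        · exact hx (Or.inr (by rw [← h, s1]))
        · exact hx (Or.inl (hinj _ _ h))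
    · intro x hx
      by_contra hne
      have h1 := (hmem x hne).1
      apply hx
      refine Finset.mem_erase.2 ⟨?_, h1⟩
      rintro rfl
      exact hne (r1 x (Or.inl rfl))
    · intro x hx hblk
      obtain ⟨h1, h2⟩ := hmem x hx
      rw [h2] at hblk
      exact s4 x h1 hblk
    · intro h; omega
    · intro u hu w hw hfu hfw _ _
      rw [hfixed u hu hfu, hfixed w hw hfw]
    · left
      intro u hu hfu hblk
      rw [hfixed u hu hfu] at hblk
      have := s4 v hv hblk
      omega
  · obtain ⟨σ, s1, s2, s3, s4⟩ := mk_pm (l := l) hmono (S.erase v) h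
      (by rw [Finset.card_erase_of_mem hv]; omega) (by
      intro j hj
      have h1 := hsmall j hj
      have h2 : ((S.erase v).filter fun x => blk x = j).card ≤
          (S.filter fun x => blk x = j).card :=
        Finset.card_le_card (Finset.filter_subset_filter _ (Finset.erase_subset _ _))
      omega)
    refine mk_ind_step hα hv (ih v hv) σ s1 s2 ?_ ?_ ?_ ?_
    · intro x hx hblk
      refine s4 x ?_ hblk
      by_contra h
      exact hx (s2 x h)
    · intro h; omega
    · intro u hu _ _ hfu _ _ _
      exact absurd hfu (s3 u hu)
    · left
      intro u hu hfu
      exact absurd hfu (s3 u hu)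

theorem mkP_all (hmono : Monotone blk) (hα : Function.Injective α) (S : Finset (Fin n)) :
    mkP blk l α S := by
  induction S using Finset.strongInduction with
  | H S ih =>
    have ih' : ∀ v ∈ S, mkP blk l α (S.erase v) := fun v hv => ih _ (Finset.erase_ssubset hv)
    by_cases h1 : ∃ v ∈ S, (blk v : ℕ) < l
    · obtain ⟨v, hv, hvl⟩ := h1
      by_cases h2 : ∃ i : Fin r, (i : ℕ) < l ∧ S.card < 2 * (S.filter fun x => blk x = i).card
      · obtain ⟨i, hi, hbig⟩ := h2
        exact mk_case_a hmono hα ih' i hi hbig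
      · push Not at h2
        exact mk_case_b hmono hα ih' v hv hvl h2
    · push Not at h1
      by_cases h2 : ∃ x ∈ S, ∃ y ∈ S, blk x ≠ blk y
      · exact mk_case_k hmono hα ih' h1 h2
      · push Not at h2
        refine ⟨0, zero_mem _, ?_⟩
        rw [eq_top_iff]
        intro X _
        refine Submodule.subset_span ⟨.inl ⟨X, ?_⟩, rfl⟩
        intro a ha c hc hac
        exact absurd (h2 a ha c hc) hac

end mkInd

end mkHelpers

/-- Theorem 4(i) of the paper: Fix `1 ≤ l ≤ r`, split
`so(n)_A = 𝔥 ⊕ 𝔨` with `𝔥 = so(k 1) ⊕ ⋯ ⊕ so(k l)`, `𝔨 = so(k (l+1)) ⊕ ⋯ ⊕ so(k r)`,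
and set `p = 𝔨 ⊕ v`. For `M ∈ p` let `F_M` be the span of the projections onto `p` of
`π((M + λA)^j)`. Then there is an open dense subset `U ⊆ p` such that for every
`M ∈ U` the subspace `F_M + 𝔨` is coisotropic inside `j_M`: every `η ∈ j_M` with
`tr(M·[ξ, η]) = 0` for all `ξ ∈ F_M + 𝔨` belongs to `F_M + 𝔨`. This expresses that the
restricted Manakov integrals together with the linear functions on `𝔨` form a complete
subset of the `Ad_H`-invariant polynomials on `p`, `H = SO(k 1) × ⋯ × SO(k l)`. -/
theorem manakov_plus_k_complete_on_p (n r : ℕ) (k : Fin r → ℕ)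
    (hk : ∀ p, 0 < k p) (hsum : ∑ p, k p = n)
    (blk : Fin n → Fin r) (hmono : Monotone blk)
    (hcard : ∀ p, (Finset.univ.filter fun i => blk i = p).card = k p)
    (α : Fin r → ℝ) (hα : Function.Injective α)
    (A : Matrix (Fin n) (Fin n) ℝ) (hA : A = Matrix.diagonal fun i => α (blk i))
    (l : ℕ) (hl1 : 1 ≤ l) (hlr : l ≤ r)
    (G : Matrix (Fin n) (Fin n) ℝ → Submodule ℝ (Matrix (Fin n) (Fin n) ℝ))
    (hG : ∀ M, G M = Submodule.span ℝ (pManakovGradients blk l A M)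
        ⊔ Submodule.span ℝ (kSet blk l)) :
    ∃ U : Set {X : Matrix (Fin n) (Fin n) ℝ // X ∈ pSet blk l},
      IsOpen U ∧ Dense U ∧
      ∀ M ∈ U, ∀ η ∈ jSet blk l M.1,
        (∀ ξ ∈ G M.1, ((M.1 : Matrix (Fin n) (Fin n) ℝ) * (ξ * η - η * ξ)).trace = 0) →
        η ∈ G M.1 := by
  obtain ⟨M0, hM0, hM0t⟩ := mkP_all (l := l) hmono hα Finset.univ
  rw [← hA] at hM0t
  have hadm : ∀ M, M ∈ mkAdm blk l Finset.univ ↔ M ∈ pSet blk l := by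
    intro M
    constructor
    · rintro ⟨h1, h2, _⟩; exact ⟨h1, h2⟩
    · rintro ⟨h1, h2⟩; exact ⟨h1, h2, fun i _ hi => absurd (Finset.mem_univ i) hi⟩
  refine ⟨{M | mkOm blk l A Finset.univ M.1 = ⊤}, ?_, ?_, ?_⟩
  · rw [isOpen_iff_mem_nhds]
    intro M hM
    exact continuous_subtype_val.continuousAt.eventually
      (mkOm_open blk l A Finset.univ M.1 hM)
  · intro M
    have h1 := mkOm_line blk l A Finset.univ M.1 (M0 - M.1) (by rwa [add_sub_cancel])
    have hmem : ∀ s : ℝ, M.1 + s • (M0 - M.1) ∈ pSet blk l := by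
      intro s
      have hM := (hadm _).2 M.2
      exact (hadm _).1 (add_mem hM (Submodule.smul_mem _ _ (sub_mem hM0 hM)))
    let γ : ℝ → {X : Matrix (Fin n) (Fin n) ℝ // X ∈ pSet blk l} :=
      fun s => ⟨M.1 + s • (M0 - M.1), hmem s⟩
    have hγ : Continuous γ := by
      apply Continuous.subtype_mk
      fun_prop
    have hγ0 : γ 0 = M := by
      apply Subtype.ext
      simp [γ]
    have ht : Filter.Tendsto γ (nhdsWithin 0 {0}ᶜ) (nhds M) := by
      have := hγ.tendsto 0
      rw [hγ0] at this
      exact this.mono_left nhdsWithin_le_nhds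
    exact mem_closure_of_tendsto ht h1
  · intro M hM η hη hξ
    rw [hG] at hξ ⊢
    exact mk_conclude hA M.2 hM hη fun ξ h => hξ ξ (Submodule.mem_sup_left h)
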